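/- Let k : 𝔻∖{0} → ℝ be a bounded, nonpositive, continuous function and let u : 𝔻∖{0} → ℝ be a C² solution of the curvature equation Δu(z) = k(z)·e^{2u(z)} on 𝔻∖{0} satisfying the finite-energy condition ∬_𝔻 e^{2u(z)} dxdy < ∞. Then there exist a real number γ > −1 and a function r : 𝔻 → ℝ continuous on all of 𝔻 such that u(z) = γ·log|z| + r(z) for all z ∈ 𝔻∖{0}. -/

import Mathlib

open Metric MeasureTheory
open scoped ENNReal

/-- The Laplacian Δu = ∂²u/∂x² + ∂²u/∂y² of a function on ℂ ≅ ℝ². -/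
noncomputable def lapl (u : ℂ → ℝ) (z : ℂ) : ℝ :=
  fderiv ℝ (fun w => fderiv ℝ u w 1) z 1
    + fderiv ℝ (fun w => fderiv ℝ u w Complex.I) z Complex.I

section

open Filter Topology Set

section Calculus

lemma continuous_mul_of_tsupport_subset {Ω : Set ℂ} (hΩ : IsOpen Ω) {φ g : ℂ → ℝ}
    (hφ : Continuous φ) (hsub : tsupport φ ⊆ Ω) (hg : ContinuousOn g Ω) :
    Continuous fun x => φ x * g x :=
  (hφ.continuousOn.mul hg).continuous_of_tsupport_subset hΩ
    ((tsupport_mul_subset_left (f := φ) (g := g)).trans hsub)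

lemma integrable_mul_of_tsupport_subset {Ω : Set ℂ} (hΩ : IsOpen Ω) {φ g : ℂ → ℝ}
    (hφ : Continuous φ) (hc : HasCompactSupport φ) (hsub : tsupport φ ⊆ Ω)
    (hg : ContinuousOn g Ω) :
    Integrable fun x => φ x * g x :=
  (continuous_mul_of_tsupport_subset hΩ hφ hsub hg).integrable_of_hasCompactSupport hc.mul_right

lemma ContDiffOn.fderiv_apply_const {Ω : Set ℂ} (hΩ : IsOpen Ω) {u : ℂ → ℝ} {m n : WithTop ℕ∞}
    (hu : ContDiffOn ℝ n u Ω) (hmn : m + 1 ≤ n) (v : ℂ) :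
    ContDiffOn ℝ m (fun w => fderiv ℝ u w v) Ω :=
  (hu.fderiv_of_isOpen hΩ hmn).clm_apply contDiffOn_const

lemma continuousOn_lapl {Ω : Set ℂ} (hΩ : IsOpen Ω) {u : ℂ → ℝ} (hu : ContDiffOn ℝ 2 u Ω) :
    ContinuousOn (lapl u) Ω := by
  have h : ∀ v : ℂ, ContinuousOn (fun z => fderiv ℝ (fun w => fderiv ℝ u w v) z v) Ω := fun v =>
    (ContDiffOn.fderiv_apply_const (m := 0) (n := 1) hΩ
      (ContDiffOn.fderiv_apply_const hΩ hu (by norm_num [one_add_one_eq_two]) v)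
        (by norm_num) v).continuousOn
  exact (h 1).add (h Complex.I)

lemma integral_mul_fderiv_fderiv_eq {Ω : Set ℂ} (hΩ : IsOpen Ω) {u φ : ℂ → ℝ}
    (hu : ContDiffOn ℝ 2 u Ω) (hφ : ContDiff ℝ 2 φ) (hc : HasCompactSupport φ)
    (hsub : tsupport φ ⊆ Ω) (v : ℂ) :
    ∫ x, φ x * fderiv ℝ (fun w => fderiv ℝ u w v) x v
      = ∫ x, fderiv ℝ (fun w => fderiv ℝ φ w v) x v * u x := by
  have hu1 : ContDiffOn ℝ 1 (fun w => fderiv ℝ u w v) Ω :=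
    ContDiffOn.fderiv_apply_const hΩ hu (by norm_num [one_add_one_eq_two]) v
  have hu2 : ContinuousOn (fun z => fderiv ℝ (fun w => fderiv ℝ u w v) z v) Ω :=
    (ContDiffOn.fderiv_apply_const (m := 0) (n := 1) hΩ hu1 (by norm_num) v).continuousOn
  have hφ1 : ContDiff ℝ 1 (fun w => fderiv ℝ φ w v) :=
    (hφ.fderiv_right (by norm_num [one_add_one_eq_two])).clm_apply contDiff_const
  have hφ2 : Continuous (fun z => fderiv ℝ (fun w => fderiv ℝ φ w v) z v) :=
    ((hφ1.fderiv_right (m := 0) (by norm_num)).clm_apply contDiff_const).continuous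
  have s1 := tsupport_fderiv_apply_subset ℝ (f := φ) v
  have s2 := tsupport_fderiv_apply_subset ℝ (f := fun w => fderiv ℝ φ w v) v
  have c1 : HasCompactSupport (fun w => fderiv ℝ φ w v) := hc.mono' (subset_closure.trans s1)
  have c2 : HasCompactSupport (fun z => fderiv ℝ (fun w => fderiv ℝ φ w v) z v) :=
    c1.mono' (subset_closure.trans s2)
  have i11 := integrable_mul_of_tsupport_subset hΩ hφ1.continuous c1 (s1.trans hsub)
    hu1.continuousOn
  have hud : ∀ x ∈ Ω, DifferentiableAt ℝ u x := fun x hx =>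
    (hu.contDiffAt (hΩ.mem_nhds hx)).differentiableAt (by norm_num)
  have e1 := integral_mul_fderiv_eq_neg_fderiv_mul_of_integrable (μ := volume) (f := φ)
    (g := fun w => fderiv ℝ u w v) (v := v) i11
    (integrable_mul_of_tsupport_subset hΩ hφ.continuous hc hsub hu2)
    (integrable_mul_of_tsupport_subset hΩ hφ.continuous hc hsub hu1.continuousOn)
    (fun x _ => (hφ.differentiable (by norm_num)) x)
    (fun x hx => (hu1.contDiffAt (hΩ.mem_nhds (hsub hx))).differentiableAt (by norm_num))
  have e2 := integral_mul_fderiv_eq_neg_fderiv_mul_of_integrable (μ := volume)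
    (f := fun w => fderiv ℝ φ w v) (g := u) (v := v)
    (integrable_mul_of_tsupport_subset hΩ hφ2 c2 ((s2.trans s1).trans hsub) hu.continuousOn)
    i11
    (integrable_mul_of_tsupport_subset hΩ hφ1.continuous c1 (s1.trans hsub) hu.continuousOn)
    (fun x _ => (hφ1.differentiable (by norm_num)) x)
    (fun x hx => hud x (hsub (s1 hx)))
  rw [e1, e2, neg_neg]

lemma tsupport_lapl_subset (φ : ℂ → ℝ) : tsupport (lapl φ) ⊆ tsupport φ := by
  have h := fun v => (tsupport_fderiv_apply_subset ℝ (f := fun w => fderiv ℝ φ w v) v).trans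
    (tsupport_fderiv_apply_subset ℝ (f := φ) v)
  refine closure_minimal ?_ isClosed_closure
  intro x hx
  by_contra hx'
  apply hx
  have h' : ∀ v, fderiv ℝ (fun w => fderiv ℝ φ w v) x v = 0 := fun v =>
    image_eq_zero_of_notMem_tsupport (f := fun x => fderiv ℝ (fun w => fderiv ℝ φ w v) x v)
      fun hh => hx' (h v hh)
  simp [lapl, h']

lemma continuous_lapl {φ : ℂ → ℝ} (hφ : ContDiff ℝ 2 φ) : Continuous (lapl φ) := by
  rw [← continuousOn_univ]
  exact continuousOn_lapl isOpen_univ hφ.contDiffOn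

/-- Green's second identity against a compactly supported function. -/
lemma integral_mul_lapl_eq {Ω : Set ℂ} (hΩ : IsOpen Ω) {u φ : ℂ → ℝ}
    (hu : ContDiffOn ℝ 2 u Ω) (hφ : ContDiff ℝ 2 φ) (hc : HasCompactSupport φ)
    (hsub : tsupport φ ⊆ Ω) :
    ∫ x, φ x * lapl u x = ∫ x, lapl φ x * u x := by
  have hu2 : ∀ v, ContinuousOn (fun z => fderiv ℝ (fun w => fderiv ℝ u w v) z v) Ω := fun v =>
    (ContDiffOn.fderiv_apply_const (m := 0) (n := 1) hΩ
      (ContDiffOn.fderiv_apply_const hΩ hu (by norm_num [one_add_one_eq_two]) v)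
        (by norm_num) v).continuousOn
  have hφ2 : ∀ v, Continuous (fun z => fderiv ℝ (fun w => fderiv ℝ φ w v) z v) := fun v => by
    have hφ1 : ContDiff ℝ 1 (fun w => fderiv ℝ φ w v) :=
      (hφ.fderiv_right (by norm_num [one_add_one_eq_two])).clm_apply contDiff_const
    exact ((hφ1.fderiv_right (m := 0) (by norm_num)).clm_apply contDiff_const).continuous
  have hs := fun v => (tsupport_fderiv_apply_subset ℝ (f := fun w => fderiv ℝ φ w v) v).trans
    (tsupport_fderiv_apply_subset ℝ (f := φ) v)
  simp only [lapl, mul_add, add_mul]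
  rw [integral_add, integral_add, integral_mul_fderiv_fderiv_eq hΩ hu hφ hc hsub,
    integral_mul_fderiv_fderiv_eq hΩ hu hφ hc hsub]
  · exact integrable_mul_of_tsupport_subset hΩ (hφ2 _) (hc.mono' (subset_closure.trans (hs _)))
      ((hs _).trans hsub) hu.continuousOn
  · exact integrable_mul_of_tsupport_subset hΩ (hφ2 _) (hc.mono' (subset_closure.trans (hs _)))
      ((hs _).trans hsub) hu.continuousOn
  · exact integrable_mul_of_tsupport_subset hΩ hφ.continuous hc hsub (hu2 _)
  · exact integrable_mul_of_tsupport_subset hΩ hφ.continuous hc hsub (hu2 _)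

lemma lapl_mul {f g : ℂ → ℝ} {z : ℂ} (hf : ContDiffAt ℝ 2 f z) (hg : ContDiffAt ℝ 2 g z) :
    lapl (fun w => f w * g w) z = f z * lapl g z + g z * lapl f z
      + 2 * (fderiv ℝ f z 1 * fderiv ℝ g z 1
        + fderiv ℝ f z Complex.I * fderiv ℝ g z Complex.I) := by
  have key : ∀ v : ℂ, fderiv ℝ (fun w => fderiv ℝ (fun w => f w * g w) w v) z v
      = f z * fderiv ℝ (fun w => fderiv ℝ g w v) z v
        + g z * fderiv ℝ (fun w => fderiv ℝ f w v) z v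
        + 2 * (fderiv ℝ f z v * fderiv ℝ g z v) := by
    intro v
    have hev : (fun w => fderiv ℝ (fun w => f w * g w) w v)
        =ᶠ[𝓝 z] fun w => f w * fderiv ℝ g w v + g w * fderiv ℝ f w v := by
      filter_upwards [hf.eventually (by simp), hg.eventually (by simp)] with w h1 h2
      rw [fderiv_fun_mul (h1.differentiableAt (by norm_num)) (h2.differentiableAt (by norm_num))]
      simp
    have hf1 : DifferentiableAt ℝ f z := hf.differentiableAt (by norm_num)
    have hg1 : DifferentiableAt ℝ g z := hg.differentiableAt (by norm_num)
    have hf2 : DifferentiableAt ℝ (fun w => fderiv ℝ f w v) z :=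
      ((hf.fderiv_right (m := 1) (by norm_num [one_add_one_eq_two])).clm_apply
        contDiffAt_const).differentiableAt (by norm_num)
    have hg2 : DifferentiableAt ℝ (fun w => fderiv ℝ g w v) z :=
      ((hg.fderiv_right (m := 1) (by norm_num [one_add_one_eq_two])).clm_apply
        contDiffAt_const).differentiableAt (by norm_num)
    rw [hev.fderiv_eq, fderiv_fun_add (hf1.fun_mul hg2) (hg1.fun_mul hf2),
      fderiv_fun_mul hf1 hg2, fderiv_fun_mul hg1 hf2]
    simp
    ring
  simp only [lapl, key]
  ring

lemma hasFDerivAt_comp_norm_sub_sq {Φ : ℝ → ℝ} {a : ℝ} {z c : ℂ}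
    (h : HasDerivAt Φ a (‖z - c‖ ^ 2)) :
    HasFDerivAt (fun w => Φ (‖w - c‖ ^ 2)) (a • (2 • innerSL ℝ (z - c))) z := by
  have h1 : HasFDerivAt (fun w : ℂ => w - c) (ContinuousLinearMap.id ℝ ℂ) z :=
    (hasFDerivAt_id z).sub_const c
  have h2 := h.comp_hasFDerivAt z h1.norm_sq
  refine h2.congr_fderiv ?_
  ext w
  simp

/-- The Laplacian of a function of the squared distance to a point. -/
lemma lapl_comp_norm_sub_sq {Φ Φ' : ℝ → ℝ} {b : ℝ} {z c : ℂ}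
    (h : ∀ᶠ q in 𝓝 (‖z - c‖ ^ 2), HasDerivAt Φ (Φ' q) q)
    (h' : HasDerivAt Φ' b (‖z - c‖ ^ 2)) :
    lapl (fun w => Φ (‖w - c‖ ^ 2)) z = 4 * Φ' (‖z - c‖ ^ 2) + 4 * ‖z - c‖ ^ 2 * b := by
  have hcont : ContinuousAt (fun w : ℂ => ‖w - c‖ ^ 2) z := by fun_prop
  have key : ∀ v : ℂ, fderiv ℝ (fun w => fderiv ℝ (fun w => Φ (‖w - c‖ ^ 2)) w v) z v
      = 2 * Φ' (‖z - c‖ ^ 2) * inner ℝ v v + 4 * b * inner ℝ (z - c) v ^ 2 := by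
    intro v
    have hev : (fun w => fderiv ℝ (fun w => Φ (‖w - c‖ ^ 2)) w v)
        =ᶠ[𝓝 z] fun w => Φ' (‖w - c‖ ^ 2) * (2 * inner ℝ (w - c) v) := by
      filter_upwards [hcont.eventually h] with w hw
      rw [(hasFDerivAt_comp_norm_sub_sq hw).fderiv]
      simp [two_smul]
      ring
    have e1 : HasFDerivAt (fun w : ℂ => (2 * inner ℝ (w - c) v : ℝ))
        ((2 : ℝ) • (innerSL ℝ v)) z := by
      have : HasFDerivAt (fun w : ℂ => w - c) (ContinuousLinearMap.id ℝ ℂ) z :=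
        (hasFDerivAt_id z).sub_const c
      have h3 := ((innerSL ℝ v).hasFDerivAt.comp z this).const_mul (2 : ℝ)
      refine (h3.congr_of_eventuallyEq (Eventually.of_forall fun w => ?_)).congr_fderiv ?_
      · simp [real_inner_comm]
      · ext w
        simp
    rw [hev.fderiv_eq, ((hasFDerivAt_comp_norm_sub_sq h').fun_mul e1).fderiv]
    simp [two_smul]
    ring
  have hn : ‖z - c‖ ^ 2 = (z - c).re ^ 2 + (z - c).im ^ 2 := by
    rw [← Complex.normSq_eq_norm_sq, Complex.normSq_apply]; ring
  simp only [lapl, key, Complex.inner]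
  rw [hn]
  simp
  ring

end Calculus

section Representation

open Module

lemma reglog_abs_le {x δ : ℝ} (hx : 0 < x) (hδ : 0 ≤ δ) (hδ1 : δ ≤ 1) :
    |1 / 2 * Real.log (x ^ 2 + δ)| ≤ x + x⁻¹ := by
  have h1 : 1 / 2 * Real.log (x ^ 2 + δ) ≤ Real.log (1 + x) := by
    have : Real.log (x ^ 2 + δ) ≤ Real.log ((1 + x) ^ 2) :=
      Real.log_le_log (by positivity) (by nlinarith)
    rw [Real.log_pow] at this
    push_cast at this
    linarith
  have h2 : Real.log x ≤ 1 / 2 * Real.log (x ^ 2 + δ) := by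
    have : Real.log (x ^ 2) ≤ Real.log (x ^ 2 + δ) :=
      Real.log_le_log (by positivity) (by linarith)
    rw [Real.log_pow] at this
    push_cast at this
    linarith
  have h3 : Real.log (1 + x) ≤ x := by
    have := Real.log_le_sub_one_of_pos (show 0 < 1 + x by linarith)
    linarith
  have h4 : -x⁻¹ ≤ Real.log x := by
    have := Real.log_le_sub_one_of_pos (inv_pos.2 hx)
    rw [Real.log_inv] at this
    linarith
  have := inv_pos.2 hx
  rw [abs_le]
  constructor <;> linarith

lemma abs_log_le_add_inv {x : ℝ} (hx : 0 < x) : |Real.log x| ≤ x + x⁻¹ := by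
  have := reglog_abs_le hx le_rfl zero_le_one
  rw [add_zero, Real.log_pow] at this
  convert this using 2
  push_cast
  ring

lemma locallyIntegrable_inv_norm_sub (z : ℂ) :
    LocallyIntegrable (fun w : ℂ => ‖w - z‖⁻¹) := by
  have h0 : LocallyIntegrable (fun w : ℂ => ‖w‖⁻¹) := by
    refine locallyIntegrable_of_norm_le_rpow (C := 1) (α := 1) ?_ ?_ ?_ ?_
    · simp [Complex.finrank_real_complex]
    · simp [Complex.finrank_real_complex]
    · refine ae_of_all _ fun w => ?_
      rw [Real.rpow_neg_one]
      simp
    · exact (by fun_prop : Measurable fun w : ℂ => ‖w‖⁻¹).aestronglyMeasurable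
  rw [locallyIntegrable_iff] at h0 ⊢
  intro K hK
  have h1 := h0 ((fun w => w - z) '' K) (hK.image (by fun_prop))
  have hm := measurePreserving_sub_right (volume : Measure ℂ) z
  exact (hm.integrableOn_image (MeasurableEquiv.subRight z).measurableEmbedding).1 h1

lemma integrable_add_inv_mul {g : ℂ → ℝ} (hg : Continuous g) (hc : HasCompactSupport g) (z : ℂ) :
    Integrable fun w => (‖w - z‖ + ‖w - z‖⁻¹) * g w := by
  have h1 : Integrable fun w => ‖w - z‖⁻¹ * g w :=
    (locallyIntegrable_inv_norm_sub z).integrable_smul_right_of_hasCompactSupport hg hc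
  have h2 : Integrable fun w => ‖w - z‖ * g w :=
    (by fun_prop : Continuous fun w => ‖w - z‖ * g w).integrable_of_hasCompactSupport hc.mul_left
  simp only [add_mul]
  exact h2.add h1

/-- The regularized logarithmic kernel. -/
noncomputable def reglog (δ : ℝ) (z w : ℂ) : ℝ := 1 / 2 * Real.log (‖w - z‖ ^ 2 + δ)

lemma contDiff_reglog {δ : ℝ} (hδ : 0 < δ) (z : ℂ) : ContDiff ℝ 2 (reglog δ z) := by
  unfold reglog
  refine contDiff_const.mul (ContDiff.log ?_ fun w => by positivity)
  exact ((contDiff_norm_sq ℝ).comp (contDiff_id.sub contDiff_const)).add contDiff_const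

lemma hasDerivAt_half_log {δ q : ℝ} (h : 0 < q + δ) :
    HasDerivAt (fun q => 1 / 2 * Real.log (q + δ)) (1 / 2 * (q + δ)⁻¹) q := by
  have := (((hasDerivAt_id q).add_const δ).log h.ne').const_mul (1 / 2 : ℝ)
  simpa using this

lemma fderiv_reglog {δ : ℝ} (hδ : 0 < δ) (z w v : ℂ) :
    fderiv ℝ (reglog δ z) w v = inner ℝ (w - z) v / (‖w - z‖ ^ 2 + δ) := by
  have h : 0 < ‖w - z‖ ^ 2 + δ := by positivity
  unfold reglog
  rw [(hasFDerivAt_comp_norm_sub_sq (hasDerivAt_half_log h)).fderiv]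
  simp [two_smul]
  field_simp
  ring

lemma lapl_reglog {δ : ℝ} (hδ : 0 < δ) (z w : ℂ) :
    lapl (reglog δ z) w = 2 * δ / (‖w - z‖ ^ 2 + δ) ^ 2 := by
  have h : 0 < ‖w - z‖ ^ 2 + δ := by positivity
  unfold reglog
  rw [lapl_comp_norm_sub_sq (Φ := fun q => 1 / 2 * Real.log (q + δ)) (Φ' := fun q => 1 / 2 * (q + δ)⁻¹)
    (b := 1 / 2 * (-1 / (‖w - z‖ ^ 2 + δ) ^ 2))]
  · field_simp
    ring
  · filter_upwards [lt_mem_nhds (show -δ < ‖w - z‖ ^ 2 by linarith)] with q hq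
    exact hasDerivAt_half_log (by linarith)
  · exact ((((hasDerivAt_id _).add_const δ).inv h.ne').const_mul (1 / 2 : ℝ))

lemma fderiv_apply_eq_re_im (φ : ℂ → ℝ) (w y : ℂ) :
    fderiv ℝ φ w y = y.re * fderiv ℝ φ w 1 + y.im * fderiv ℝ φ w Complex.I := by
  have : y = y.re • (1 : ℂ) + y.im • Complex.I := by
    simp
  conv_lhs => rw [this]
  rw [map_add, map_smul, map_smul]
  rfl

lemma lapl_reglog_mul {δ : ℝ} (hδ : 0 < δ) (z w : ℂ) {φ : ℂ → ℝ} (hφ : ContDiff ℝ 2 φ) :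
    lapl (fun w => reglog δ z w * φ w) w = reglog δ z w * lapl φ w
      + φ w * (2 * δ / (‖w - z‖ ^ 2 + δ) ^ 2)
      + 2 * (fderiv ℝ φ w (w - z) / (‖w - z‖ ^ 2 + δ)) := by
  rw [lapl_mul (contDiff_reglog hδ z).contDiffAt hφ.contDiffAt, lapl_reglog hδ,
    fderiv_reglog hδ, fderiv_reglog hδ, fderiv_apply_eq_re_im φ w (w - z)]
  simp [Complex.inner]
  ring

/-- The total mass of the Laplacian of the regularized logarithm. -/
noncomputable def logMass : ℝ := ∫ x : ℂ, 2 / (1 + ‖x‖ ^ 2) ^ 2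

lemma integrable_logMass : Integrable fun x : ℂ => 2 / (1 + ‖x‖ ^ 2) ^ 2 := by
  have h := (integrable_rpow_neg_one_add_norm_sq (E := ℂ) (μ := volume) (r := 4)
    (by rw [Complex.finrank_real_complex]; norm_num)).const_mul 2
  refine h.congr (ae_of_all _ fun x => ?_)
  have : (0 : ℝ) < 1 + ‖x‖ ^ 2 := by positivity
  simp only
  rw [show (-4 / 2 : ℝ) = -((2 : ℕ) : ℝ) by norm_num, Real.rpow_neg this.le, Real.rpow_natCast]
  rfl

lemma logMass_pos : 0 < logMass := by
  unfold logMass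
  rw [integral_pos_iff_support_of_nonneg (fun x => by positivity) integrable_logMass]
  have : (Function.support fun x : ℂ => 2 / (1 + ‖x‖ ^ 2) ^ 2) = univ := by
    ext x
    have : (0 : ℝ) < 2 / (1 + ‖x‖ ^ 2) ^ 2 := by positivity
    exact iff_of_true this.ne' trivial
  rw [this]
  simp

lemma tendsto_integral_lapl_reglog {g : ℂ → ℝ} (hg : Continuous g) (hc : HasCompactSupport g)
    (z : ℂ) :
    Tendsto (fun c : ℝ => ∫ w, 2 * (c ^ 2)⁻¹ / (‖w - z‖ ^ 2 + (c ^ 2)⁻¹) ^ 2 * g w) atTop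
      (𝓝 (logMass * g z)) := by
  have hm := logMass_pos
  have h := tendsto_integral_comp_smul_smul_of_integrable' (μ := (volume : Measure ℂ))
    (φ := fun x : ℂ => logMass⁻¹ * (2 / (1 + ‖x‖ ^ 2) ^ 2)) (fun x => by positivity)
    (by rw [integral_const_mul]; exact inv_mul_cancel₀ hm.ne') (by
      have h1 : Tendsto (fun x : ℂ => logMass⁻¹ * 2 * (‖x‖ ^ 2)⁻¹)
          (Bornology.cobounded ℂ) (𝓝 (logMass⁻¹ * 2 * 0)) := by
        refine Tendsto.const_mul _ ?_
        exact tendsto_inv_atTop_zero.comp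
          ((tendsto_pow_atTop two_ne_zero).comp tendsto_norm_cobounded_atTop)
      rw [mul_zero] at h1
      refine squeeze_zero (fun x => by positivity) (fun x => ?_) h1
      rw [Complex.finrank_real_complex]
      rcases eq_or_ne x 0 with rfl | hx
      · simp
      have : 0 < ‖x‖ := norm_pos_iff.2 hx
      rw [show ‖x‖ ^ 2 * (logMass⁻¹ * (2 / (1 + ‖x‖ ^ 2) ^ 2))
        = logMass⁻¹ * 2 * (‖x‖ ^ 2 / (1 + ‖x‖ ^ 2) ^ 2) by ring]
      gcongr
      rw [div_le_iff₀ (by positivity), inv_mul_eq_div, le_div_iff₀ (by positivity)]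
      nlinarith [sq_nonneg ‖x‖])
    (hg.integrable_of_hasCompactSupport hc) (hg.continuousAt (x := z))
  have h2 := h.const_mul logMass
  refine h2.congr' ?_
  filter_upwards [eventually_gt_atTop 0] with c hcpos
  rw [← integral_const_mul]
  congr 1
  ext w
  rw [Complex.finrank_real_complex, norm_smul, norm_sub_rev, Real.norm_of_nonneg hcpos.le,
    smul_eq_mul]
  field_simp
  ring

/-- Representation formula: Green's identity against a truncated logarithmic kernel. -/
lemma lapl_representation {Ω : Set ℂ} (hΩ : IsOpen Ω) {u φ : ℂ → ℝ}
    (hu : ContDiffOn ℝ 2 u Ω) (hφ : ContDiff ℝ 2 φ) (hc : HasCompactSupport φ)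
    (hsub : tsupport φ ⊆ Ω) (z : ℂ) :
    ∫ w, Real.log ‖w - z‖ * (φ w * lapl u w) = logMass * (φ z * u z)
      + ∫ w, (Real.log ‖w - z‖ * (lapl φ w * u w)
          + 2 * (fderiv ℝ φ w (w - z) * u w / ‖w - z‖ ^ 2)) := by
  have hfd : Continuous (fun w => fderiv ℝ φ w) := hφ.continuous_fderiv (by norm_num)
  have g0 : Continuous fun w => φ w * lapl u w :=
    continuous_mul_of_tsupport_subset hΩ hφ.continuous hsub (continuousOn_lapl hΩ hu)
  have c0 : HasCompactSupport fun w => φ w * lapl u w := hc.mul_right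
  have g1 : Continuous fun w => φ w * u w :=
    continuous_mul_of_tsupport_subset hΩ hφ.continuous hsub hu.continuousOn
  have c1 : HasCompactSupport fun w => φ w * u w := hc.mul_right
  have g2 : Continuous fun w => lapl φ w * u w :=
    continuous_mul_of_tsupport_subset hΩ (continuous_lapl hφ) ((tsupport_lapl_subset φ).trans hsub)
      hu.continuousOn
  have c2 : HasCompactSupport fun w => lapl φ w * u w :=
    (hc.mono' (subset_closure.trans (tsupport_lapl_subset φ))).mul_right
  have g3 : Continuous fun w => ‖fderiv ℝ φ w‖ * u w :=
    continuous_mul_of_tsupport_subset hΩ hfd.norm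
      ((closure_mono (by intro x; simp)).trans ((tsupport_fderiv_subset ℝ (f := φ)).trans hsub))
      hu.continuousOn
  have c3 : HasCompactSupport fun w => ‖fderiv ℝ φ w‖ * u w := (hc.fderiv ℝ).norm.mul_right
  have s4 : tsupport (fun w => fderiv ℝ φ w (w - z)) ⊆ tsupport φ := by
    refine (closure_mono ?_).trans (tsupport_fderiv_subset ℝ (f := φ))
    intro x hx h0
    exact hx (by simp [h0])
  have g4 : Continuous fun w => fderiv ℝ φ w (w - z) * u w :=
    continuous_mul_of_tsupport_subset hΩ (hfd.clm_apply (by fun_prop)) (s4.trans hsub)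
      hu.continuousOn
  have c4 : HasCompactSupport fun w => fderiv ℝ φ w (w - z) * u w :=
    (hc.mono' (subset_closure.trans s4)).mul_right
  have hcr : ∀ δ > 0, Continuous (reglog δ z) := fun δ hδ => (contDiff_reglog hδ z).continuous
  have hden : ∀ δ > 0, Continuous fun w : ℂ => (‖w - z‖ ^ 2 + δ)⁻¹ := fun δ hδ =>
    (by fun_prop : Continuous fun w : ℂ => ‖w - z‖ ^ 2 + δ).inv₀ fun w => by positivity
  have key : ∀ δ > 0, ∫ w, reglog δ z w * (φ w * lapl u w)
      = (∫ w, 2 * δ / (‖w - z‖ ^ 2 + δ) ^ 2 * (φ w * u w))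
        + ∫ w, (reglog δ z w * (lapl φ w * u w)
          + 2 * (fderiv ℝ φ w (w - z) * u w / (‖w - z‖ ^ 2 + δ))) := by
    intro δ hδ
    have h := integral_mul_lapl_eq hΩ hu ((contDiff_reglog hδ z).mul hφ) hc.mul_left
      ((tsupport_mul_subset_right (f := reglog δ z) (g := φ)).trans hsub)
    rw [← integral_add]
    · convert h using 1
      · congr 1
        ext w
        ring
      · congr 1
        ext w
        erw [lapl_reglog_mul hδ z w hφ]
        ring
    · refine Continuous.integrable_of_hasCompactSupport ?_ c1.mul_left
      simp only [div_eq_mul_inv, ← inv_pow]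
      exact (continuous_const.mul ((hden δ hδ).pow 2)).mul g1
    · refine Integrable.add ?_ (Integrable.const_mul ?_ 2)
      · exact ((hcr δ hδ).mul g2).integrable_of_hasCompactSupport c2.mul_left
      · simp only [div_eq_mul_inv]
        exact (g4.mul (hden δ hδ)).integrable_of_hasCompactSupport c4.mul_right
  have hδlim : Tendsto (fun c : ℝ => (c ^ 2)⁻¹) atTop (𝓝 0) :=
    tendsto_inv_atTop_zero.comp (tendsto_pow_atTop two_ne_zero)
  have hae : ∀ᵐ w : ℂ, w ≠ z := by simp [ae_iff, measure_singleton]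
  have hpt : ∀ w : ℂ, w ≠ z →
      Tendsto (fun c : ℝ => reglog (c ^ 2)⁻¹ z w) atTop (𝓝 (Real.log ‖w - z‖)) := by
    intro w hw
    have hp : 0 < ‖w - z‖ := norm_pos_iff.2 (sub_ne_zero.2 hw)
    have : Tendsto (fun c : ℝ => 1 / 2 * Real.log (‖w - z‖ ^ 2 + (c ^ 2)⁻¹)) atTop
        (𝓝 (1 / 2 * Real.log (‖w - z‖ ^ 2 + 0))) :=
      ((hδlim.const_add _).log (by positivity)).const_mul _
    rwa [add_zero, Real.log_pow, Nat.cast_ofNat, ← mul_assoc,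
      one_div_mul_cancel two_ne_zero, one_mul] at this
  have hb : ∀ c : ℝ, 1 ≤ c → ∀ w : ℂ, w ≠ z →
      |reglog (c ^ 2)⁻¹ z w| ≤ ‖w - z‖ + ‖w - z‖⁻¹ := fun c h1 w hw =>
    reglog_abs_le (norm_pos_iff.2 (sub_ne_zero.2 hw)) (by positivity)
      (inv_le_one_of_one_le₀ (one_le_pow₀ h1))
  have t1 : Tendsto (fun c : ℝ => ∫ w, reglog (c ^ 2)⁻¹ z w * (φ w * lapl u w)) atTop
      (𝓝 (∫ w, Real.log ‖w - z‖ * (φ w * lapl u w))) := by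
    refine tendsto_integral_filter_of_dominated_convergence
      (fun w => (‖w - z‖ + ‖w - z‖⁻¹) * ‖φ w * lapl u w‖) ?_ ?_
      (integrable_add_inv_mul g0.norm c0.norm z) ?_
    · filter_upwards [eventually_ge_atTop 1] with c h1
      exact ((hcr _ (by positivity)).mul g0).aestronglyMeasurable
    · filter_upwards [eventually_ge_atTop 1] with c h1
      filter_upwards [hae] with w hw
      rw [norm_mul]
      gcongr
      exact hb c h1 w hw
    · filter_upwards [hae] with w hw
      exact (hpt w hw).mul_const _
  have t3 : Tendsto (fun c : ℝ => ∫ w, (reglog (c ^ 2)⁻¹ z w * (lapl φ w * u w)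
          + 2 * (fderiv ℝ φ w (w - z) * u w / (‖w - z‖ ^ 2 + (c ^ 2)⁻¹)))) atTop
      (𝓝 (∫ w, (Real.log ‖w - z‖ * (lapl φ w * u w)
          + 2 * (fderiv ℝ φ w (w - z) * u w / ‖w - z‖ ^ 2)))) := by
    refine tendsto_integral_filter_of_dominated_convergence
      (fun w => (‖w - z‖ + ‖w - z‖⁻¹) * ‖lapl φ w * u w‖
        + 2 * ((‖w - z‖ + ‖w - z‖⁻¹) * ‖‖fderiv ℝ φ w‖ * u w‖)) ?_ ?_
      ((integrable_add_inv_mul g2.norm c2.norm z).add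
        ((integrable_add_inv_mul g3.norm c3.norm z).const_mul 2)) ?_
    · filter_upwards [eventually_ge_atTop 1] with c h1
      have h1 := (hcr (c ^ 2)⁻¹ (by positivity)).mul g2
      have h2 := (g4.mul (hden (c ^ 2)⁻¹ (by positivity))).const_smul (2 : ℝ)
      simp only [div_eq_mul_inv]
      exact (h1.add h2).aestronglyMeasurable
    · filter_upwards [eventually_ge_atTop 1] with c h1
      filter_upwards [hae] with w hw
      have hp : 0 < ‖w - z‖ := norm_pos_iff.2 (sub_ne_zero.2 hw)
      refine (norm_add_le _ _).trans (add_le_add ?_ ?_)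
      · rw [norm_mul]
        gcongr
        exact hb c h1 w hw
      · rw [norm_mul, Real.norm_two, norm_div, norm_mul, norm_mul, norm_norm]
        gcongr
        rw [Real.norm_of_nonneg (by positivity : 0 ≤ ‖w - z‖ ^ 2 + (c ^ 2)⁻¹),
          div_le_iff₀ (by positivity)]
        calc ‖fderiv ℝ φ w (w - z)‖ * ‖u w‖ ≤ (‖fderiv ℝ φ w‖ * ‖w - z‖) * ‖u w‖ := by
              gcongr
              exact ContinuousLinearMap.le_opNorm _ _
          _ = (‖w - z‖⁻¹ * ‖w - z‖ ^ 2) * (‖fderiv ℝ φ w‖ * ‖u w‖) := by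
              field_simp
          _ ≤ ((‖w - z‖ + ‖w - z‖⁻¹) * (‖w - z‖ ^ 2 + (c ^ 2)⁻¹))
              * (‖fderiv ℝ φ w‖ * ‖u w‖) := by
              gcongr
              · linarith
              · have : 0 ≤ (c ^ 2)⁻¹ := by positivity
                linarith
          _ = _ := by ring
    · filter_upwards [hae] with w hw
      have hp : 0 < ‖w - z‖ := norm_pos_iff.2 (sub_ne_zero.2 hw)
      refine ((hpt w hw).mul_const _).add (Tendsto.const_mul 2 ?_)
      have := hδlim.const_add (‖w - z‖ ^ 2)
      rw [add_zero] at this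
      exact tendsto_const_nhds.div this (by positivity)
  have t2 := tendsto_integral_lapl_reglog g1 c1 z
  refine tendsto_nhds_unique t1 ((t2.add t3).congr' ?_)
  filter_upwards [eventually_gt_atTop 0] with c h1
  exact (key _ (by positivity)).symm

end Representation

section Radial

lemma contDiff_two_of_hasDerivAt {P P₁ P₂ : ℝ → ℝ} (h1 : ∀ t, HasDerivAt P (P₁ t) t)
    (h2 : ∀ t, HasDerivAt P₁ (P₂ t) t) (hP : Continuous P₂) : ContDiff ℝ 2 P := by
  have d1 : deriv P = P₁ := funext fun t => (h1 t).deriv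
  have d2 : deriv P₁ = P₂ := funext fun t => (h2 t).deriv
  rw [show (2 : WithTop ℕ∞) = 1 + 1 by norm_num, contDiff_succ_iff_deriv]
  refine ⟨fun t => (h1 t).differentiableAt, by simp, ?_⟩
  rw [d1, contDiff_one_iff_deriv, d2]
  exact ⟨fun t => (h2 t).differentiableAt, hP⟩

lemma tsupport_radial_subset {P : ℝ → ℝ} {a : ℝ} (ha : ∀ t ≤ a, P t = 0)
    (hb : ∀ t, -1 ≤ t → P t = 0) :
    tsupport (fun w : ℂ => P (Real.log ‖w‖)) ⊆ closedBall 0 (Real.exp (-1)) \ ball 0 (Real.exp a) := by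
  refine closure_minimal ?_ (isClosed_closedBall.sdiff isOpen_ball)
  intro w hw
  rcases eq_or_ne w 0 with rfl | h0
  · exact absurd (by simpa using hb 0 (by norm_num)) hw
  have hp : 0 < ‖w‖ := norm_pos_iff.2 h0
  simp only [Set.mem_sdiff, mem_closedBall, dist_zero_right, mem_ball, not_lt]
  constructor
  · by_contra! h
    exact hw (hb _ ((Real.le_log_iff_exp_le hp).2 h.le))
  · by_contra! h
    exact hw (ha _ ((Real.log_le_iff_le_exp hp).2 h.le))

lemma annulus_subset_punctured {a : ℝ} : closedBall (0 : ℂ) (Real.exp (-1)) \ ball 0 (Real.exp a)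
    ⊆ ball (0 : ℂ) 1 \ {0} := by
  intro w hw
  have h1 : Real.exp (-1) < 1 := by rw [Real.exp_lt_one_iff]; norm_num
  simp only [Set.mem_sdiff, mem_closedBall, dist_zero_right, mem_ball, not_lt] at hw
  refine ⟨by simpa using hw.1.trans_lt h1, ?_⟩
  rintro rfl
  have := hw.2
  rw [norm_zero] at this
  exact absurd (Real.exp_pos a) (not_lt.2 this)

lemma isOpen_punctured : IsOpen (ball (0 : ℂ) 1 \ {0}) := isOpen_ball.sdiff isClosed_singleton

lemma contDiff_radial {P : ℝ → ℝ} (hP : ContDiff ℝ 2 P) {a : ℝ} (ha : ∀ t ≤ a, P t = 0)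
    (hb : ∀ t, -1 ≤ t → P t = 0) : ContDiff ℝ 2 (fun w : ℂ => P (Real.log ‖w‖)) := by
  rw [contDiff_iff_contDiffAt]
  intro w
  by_cases hw : w ∈ tsupport (fun w : ℂ => P (Real.log ‖w‖))
  · have h0 : w ≠ 0 := fun h =>
      (annulus_subset_punctured (tsupport_radial_subset ha hb hw)).2 (by simp [h])
    exact hP.contDiffAt.comp w ((contDiffAt_norm ℝ h0).log (norm_ne_zero_iff.2 h0))
  · exact contDiffAt_const (c := (0 : ℝ)) |>.congr_of_eventuallyEq
      (notMem_tsupport_iff_eventuallyEq.1 hw)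

lemma hasCompactSupport_radial {P : ℝ → ℝ} {a : ℝ} (ha : ∀ t ≤ a, P t = 0)
    (hb : ∀ t, -1 ≤ t → P t = 0) : HasCompactSupport (fun w : ℂ => P (Real.log ‖w‖)) :=
  (isCompact_closedBall (0 : ℂ) (Real.exp (-1))).of_isClosed_subset isClosed_closure
    ((tsupport_radial_subset ha hb).trans Set.sdiff_subset)

lemma radial_eq (P : ℝ → ℝ) (w : ℂ) :
    P (Real.log ‖w‖) = P (1 / 2 * Real.log (‖w - 0‖ ^ 2)) := by
  rw [sub_zero, Real.log_pow]
  congr 1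
  push_cast
  ring

lemma hasDerivAt_comp_half_log {P : ℝ → ℝ} {a q : ℝ} (hq : q ≠ 0)
    (h1 : HasDerivAt P a (1 / 2 * Real.log q)) :
    HasDerivAt (fun q => P (1 / 2 * Real.log q)) (a * (1 / 2 * q⁻¹)) q :=
  h1.comp q ((Real.hasDerivAt_log hq).const_mul (1 / 2))

lemma half_log_norm_sub_zero_sq (w : ℂ) : 1 / 2 * Real.log (‖w - 0‖ ^ 2) = Real.log ‖w‖ := by
  rw [sub_zero, Real.log_pow]
  push_cast
  ring

lemma fderiv_radial {P P₁ : ℝ → ℝ} (h1 : ∀ t, HasDerivAt P (P₁ t) t) {w : ℂ} (hw : w ≠ 0)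
    (v : ℂ) : fderiv ℝ (fun w : ℂ => P (Real.log ‖w‖)) w v
      = P₁ (Real.log ‖w‖) / ‖w‖ ^ 2 * inner ℝ w v := by
  have hq : ‖w - 0‖ ^ 2 ≠ 0 := by simpa using hw
  simp only [radial_eq P]
  rw [(hasFDerivAt_comp_norm_sub_sq (Φ := fun q => P (1 / 2 * Real.log q))
    (hasDerivAt_comp_half_log hq (h1 _))).fderiv, half_log_norm_sub_zero_sq]
  simp [two_smul]
  field_simp
  ring

lemma lapl_radial {P P₁ P₂ : ℝ → ℝ} (h1 : ∀ t, HasDerivAt P (P₁ t) t)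
    (h2 : ∀ t, HasDerivAt P₁ (P₂ t) t) {w : ℂ} (hw : w ≠ 0) :
    lapl (fun w : ℂ => P (Real.log ‖w‖)) w = P₂ (Real.log ‖w‖) / ‖w‖ ^ 2 := by
  have hq : ‖w - 0‖ ^ 2 ≠ 0 := by simpa using hw
  simp only [radial_eq P]
  rw [lapl_comp_norm_sub_sq (Φ := fun q => P (1 / 2 * Real.log q))
    (Φ' := fun q => P₁ (1 / 2 * Real.log q) * (1 / 2 * q⁻¹))
    (b := P₂ (1 / 2 * Real.log (‖w - 0‖ ^ 2)) * (1 / 2 * (‖w - 0‖ ^ 2)⁻¹) * (1 / 2 * (‖w - 0‖ ^ 2)⁻¹)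
      + P₁ (1 / 2 * Real.log (‖w - 0‖ ^ 2)) * (1 / 2 * (-((‖w - 0‖ ^ 2) ^ 2)⁻¹)))]
  · rw [half_log_norm_sub_zero_sq, sub_zero]
    have : ‖w‖ ≠ 0 := by simpa using hw
    field_simp
    ring
  · filter_upwards [eventually_ne_nhds hq] with q hq'
    exact hasDerivAt_comp_half_log hq' (h1 _)
  · exact (hasDerivAt_comp_half_log hq (h2 _)).mul ((hasDerivAt_inv hq).const_mul (1 / 2))

lemma hasDerivAt_posPart_pow (n : ℕ) (t : ℝ) :
    HasDerivAt (fun t => max t 0 ^ (n + 2)) ((n + 2) * max t 0 ^ (n + 1)) t := by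
  rcases lt_trichotomy t 0 with h | rfl | h
  · have : (fun t : ℝ => max t 0 ^ (n + 2)) =ᶠ[𝓝 t] fun _ => 0 := by
      filter_upwards [gt_mem_nhds h] with s hs
      rw [max_eq_right hs.le]
      simp
    rw [max_eq_right h.le]
    simpa using (hasDerivAt_const t (0 : ℝ)).congr_of_eventuallyEq this
  · have : HasFDerivAt (fun t : ℝ => max t 0 ^ (n + 2)) (0 : ℝ →L[ℝ] ℝ) 0 := by
      refine Asymptotics.IsBigO.hasFDerivAt (n := n + 2) ?_ (by omega)
      refine Asymptotics.IsBigO.of_bound 1 (Eventually.of_forall fun s => ?_)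
      rw [one_mul, sub_zero, norm_pow, norm_pow, norm_norm]
      gcongr
      rw [Real.norm_of_nonneg (le_max_right _ _), Real.norm_eq_abs]
      exact max_le (le_abs_self _) (abs_nonneg _)
    simpa using this.hasDerivAt
  · have : (fun t : ℝ => max t 0 ^ (n + 2)) =ᶠ[𝓝 t] fun t => t ^ (n + 2) := by
      filter_upwards [lt_mem_nhds h] with s hs
      rw [max_eq_left hs.le]
    rw [max_eq_left h.le]
    simpa using (hasDerivAt_pow (n + 2) t).congr_of_eventuallyEq this

/-- The piecewise linear hat function supported in `[-1, 1]`. -/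
noncomputable def hat (t : ℝ) : ℝ := max (t + 1) 0 - 2 * max t 0 + max (t - 1) 0

/-- The derivative of `hatPrim`. -/
noncomputable def hatPrimDeriv (t : ℝ) : ℝ :=
  (max (t + 1) 0 ^ 2 - 2 * max t 0 ^ 2 + max (t - 1) 0 ^ 2) / 2

/-- The second primitive of `hat` that vanishes near `-∞`. -/
noncomputable def hatPrim (t : ℝ) : ℝ :=
  (max (t + 1) 0 ^ 3 - 2 * max t 0 ^ 3 + max (t - 1) 0 ^ 3) / 6

lemma hasDerivAt_hatPrim (t : ℝ) : HasDerivAt hatPrim (hatPrimDeriv t) t := by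
  have h := hasDerivAt_posPart_pow 1
  have := (((((h (t + 1)).comp_add_const t 1).sub ((h t).const_mul 2)).add
    ((h (t - 1)).comp_sub_const t 1)).div_const 6)
  refine this.congr_deriv ?_
  unfold hatPrimDeriv
  push_cast
  ring

lemma hasDerivAt_hatPrimDeriv (t : ℝ) : HasDerivAt hatPrimDeriv (hat t) t := by
  have h := hasDerivAt_posPart_pow 0
  have := (((((h (t + 1)).comp_add_const t 1).sub ((h t).const_mul 2)).add
    ((h (t - 1)).comp_sub_const t 1)).div_const 2)
  refine this.congr_deriv ?_
  unfold hat
  push_cast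
  ring

lemma continuous_hat : Continuous hat := by unfold hat; fun_prop

lemma hat_nonneg (t : ℝ) : 0 ≤ hat t := by
  unfold hat
  rcases max_cases (t + 1) 0 with h | h <;> rcases max_cases t 0 with h' | h' <;>
    rcases max_cases (t - 1) 0 with h'' | h'' <;> linarith

lemma hat_le_one (t : ℝ) : hat t ≤ 1 := by
  unfold hat
  rcases max_cases (t + 1) 0 with h | h <;> rcases max_cases t 0 with h' | h' <;>
    rcases max_cases (t - 1) 0 with h'' | h'' <;> linarith

lemma hat_eq_zero {t : ℝ} (h : 1 ≤ |t|) : hat t = 0 := by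
  unfold hat
  rcases le_abs.1 h with h | h
  · rw [max_eq_left (by linarith), max_eq_left (by linarith), max_eq_left (by linarith)]; ring
  · rw [max_eq_right (by linarith), max_eq_right (by linarith), max_eq_right (by linarith)]; ring

lemma half_le_hat {t : ℝ} (h : |t| ≤ 1 / 2) : 1 / 2 ≤ hat t := by
  rw [abs_le] at h
  unfold hat
  rcases max_cases (t + 1) 0 with h | h <;> rcases max_cases t 0 with h' | h' <;>
    rcases max_cases (t - 1) 0 with h'' | h'' <;> linarith

lemma hatPrim_eq_zero {t : ℝ} (h : t ≤ -1) : hatPrim t = 0 := by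
  unfold hatPrim
  rw [max_eq_right (by linarith), max_eq_right (by linarith), max_eq_right (by linarith)]; ring

lemma hatPrim_eq_self {t : ℝ} (h : 1 ≤ t) : hatPrim t = t := by
  unfold hatPrim
  rw [max_eq_left (by linarith), max_eq_left (by linarith), max_eq_left (by linarith)]; ring

lemma hatPrim_nonneg (t : ℝ) : 0 ≤ hatPrim t := by
  have hm : Monotone hatPrimDeriv := monotone_of_hasDerivAt_nonneg hasDerivAt_hatPrimDeriv
    fun t => hat_nonneg t
  have h0 : ∀ t, 0 ≤ hatPrimDeriv t := fun t => by
    have h1 : hatPrimDeriv (min t (-1)) = 0 := by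
      have := min_le_right t (-1)
      unfold hatPrimDeriv
      rw [max_eq_right (by linarith), max_eq_right (by linarith), max_eq_right (by linarith)]; ring
    rw [← h1]
    exact hm (min_le_left _ _)
  have hm' : Monotone hatPrim := monotone_of_hasDerivAt_nonneg hasDerivAt_hatPrim fun t => h0 t
  rw [← hatPrim_eq_zero (min_le_right t (-1))]
  exact hm' (min_le_left _ _)

lemma hatPrim_le {t b : ℝ} (h : t + 1 ≤ b) (hb : 0 ≤ b) : hatPrim t ≤ b := by
  rcases le_or_gt t (-1) with h1 | h1
  · rw [hatPrim_eq_zero h1]; exact hb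
  rcases le_or_gt 1 t with h2 | h2
  · rw [hatPrim_eq_self h2]; linarith
  refine le_trans ?_ h
  unfold hatPrim
  rw [max_eq_left (by linarith : 0 ≤ t + 1), max_eq_right (by linarith : t - 1 ≤ 0)]
  rcases max_cases t 0 with h' | h'
  · rw [h'.1]
    nlinarith [mul_nonneg h'.2 h'.2, mul_nonneg h'.2 (sub_nonneg.2 h2.le),
      pow_nonneg h'.2 3]
  · rw [h'.1]
    have h3 : 0 ≤ t + 1 := by linarith
    nlinarith [mul_nonneg h3 h3, mul_nonneg (mul_nonneg h3 h3) (by linarith : 0 ≤ -t)]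

end Radial

section Estimates

/-- The closed annulus `exp a ≤ ‖w‖ ≤ exp b`. -/
def annulus (a b : ℝ) : Set ℂ := closedBall 0 (Real.exp b) \ ball 0 (Real.exp a)

lemma mem_annulus {a b : ℝ} {w : ℂ} :
    w ∈ annulus a b ↔ Real.exp a ≤ ‖w‖ ∧ ‖w‖ ≤ Real.exp b := by
  simp only [annulus, Set.mem_sdiff, mem_closedBall, dist_zero_right, mem_ball, not_lt]
  exact and_comm

lemma isCompact_annulus (a b : ℝ) : IsCompact (annulus a b) :=
  (isCompact_closedBall _ _).diff isOpen_ball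

lemma ne_zero_of_mem_annulus {a b : ℝ} {w : ℂ} (hw : w ∈ annulus a b) : w ≠ 0 := by
  rintro rfl
  have := (mem_annulus.1 hw).1
  rw [norm_zero] at this
  exact absurd (Real.exp_pos a) (not_lt.2 this)

lemma mem_annulus_of_log {a b : ℝ} {w : ℂ} (hw : w ≠ 0) (ha : a ≤ Real.log ‖w‖)
    (hb : Real.log ‖w‖ ≤ b) : w ∈ annulus a b := by
  have hp : 0 < ‖w‖ := norm_pos_iff.2 hw
  exact mem_annulus.2 ⟨(Real.le_log_iff_exp_le hp).1 ha, (Real.log_le_iff_le_exp hp).1 hb⟩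

lemma annulus_subset {a b : ℝ} (hb : b ≤ -1) : annulus a b ⊆ ball (0 : ℂ) 1 \ {0} := by
  refine subset_trans ?_ (annulus_subset_punctured (a := a))
  exact Set.sdiff_subset_sdiff_left (closedBall_subset_closedBall (Real.exp_le_exp.2 hb))

lemma integrable_radial_mul {p : ℝ → ℝ} (hp : Continuous p) {a b : ℝ}
    (h : ∀ t, p t ≠ 0 → a ≤ t ∧ t ≤ b) {g : ℂ → ℝ} (hg : ContinuousOn g (annulus a b)) :
    Integrable fun w => p (Real.log ‖w‖) / ‖w‖ ^ 2 * g w := by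
  have h1 : IntegrableOn (fun w => p (Real.log ‖w‖) / ‖w‖ ^ 2 * g w) (annulus a b) := by
    refine ContinuousOn.integrableOn_compact (isCompact_annulus a b) (ContinuousOn.mul ?_ hg)
    refine ContinuousOn.div ?_ (by fun_prop) fun w hw => ?_
    · refine hp.comp_continuousOn (ContinuousOn.log (by fun_prop) fun w hw => ?_)
      exact norm_ne_zero_iff.2 (ne_zero_of_mem_annulus hw)
    · have := norm_ne_zero_iff.2 (ne_zero_of_mem_annulus hw)
      positivity
  refine h1.integrable_of_forall_notMem_eq_zero fun w hw => ?_
  rcases eq_or_ne w 0 with rfl | h0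
  · simp
  · by_cases hz : p (Real.log ‖w‖) = 0
    · simp [hz]
    · exact absurd (mem_annulus_of_log h0 (h _ hz).1 (h _ hz).2) hw

lemma hat_ne_zero {a t : ℝ} (h : hat (t + a) ≠ 0) : -1 - a ≤ t ∧ t ≤ 1 - a := by
  have : |t + a| < 1 := by
    by_contra! h'
    exact h (hat_eq_zero h')
  rw [abs_lt] at this
  constructor <;> linarith

lemma integrable_hat_mul {u : ℂ → ℝ} (hu : ContinuousOn u (ball (0 : ℂ) 1 \ {0})) {a : ℝ}
    (ha : 2 ≤ a) : Integrable fun w => hat (Real.log ‖w‖ + a) / ‖w‖ ^ 2 * u w :=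
  integrable_radial_mul (p := fun t => hat (t + a)) (continuous_hat.comp (by fun_prop))
    (fun _ => hat_ne_zero) (hu.mono (annulus_subset (by linarith)))

/-- A lower bound for the logarithmic-scale means of a function with integrable Laplacian. -/
lemma neg_integral_hat_le {u : ℂ → ℝ} (hu : ContDiffOn ℝ 2 u (ball (0 : ℂ) 1 \ {0}))
    (hf : IntegrableOn (lapl u) (ball (0 : ℂ) 1 \ {0})) :
    ∃ C, 0 ≤ C ∧ ∀ T, 3 ≤ T →
      -(∫ w, hat (Real.log ‖w‖ + T) / ‖w‖ ^ 2 * u w) ≤ C * T := by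
  set Ω := ball (0 : ℂ) 1 \ {0} with hΩ
  set H : ℝ → ℝ := fun a => ∫ w, hat (Real.log ‖w‖ + a) / ‖w‖ ^ 2 * u w with hH
  set F : ℝ := ∫ w in Ω, |lapl u w|
  have hF : 0 ≤ F := integral_nonneg fun _ => abs_nonneg _
  refine ⟨|H 3| + |H 2| + 6 * F, by positivity, fun T hT => ?_⟩
  set P : ℝ → ℝ := fun t => hatPrim (t + T) - (T - 2) * hatPrim (t + 3) + (T - 3) * hatPrim (t + 2)
    with hP
  set P₁ : ℝ → ℝ := fun t => hatPrimDeriv (t + T) - (T - 2) * hatPrimDeriv (t + 3)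
    + (T - 3) * hatPrimDeriv (t + 2) with hP₁
  set P₂ : ℝ → ℝ := fun t => hat (t + T) - (T - 2) * hat (t + 3) + (T - 3) * hat (t + 2) with hP₂
  have d1 : ∀ t, HasDerivAt P (P₁ t) t := fun t =>
    (((hasDerivAt_hatPrim _).comp_add_const t T).sub
      (((hasDerivAt_hatPrim _).comp_add_const t 3).const_mul _)).add
      (((hasDerivAt_hatPrim _).comp_add_const t 2).const_mul _)
  have d2 : ∀ t, HasDerivAt P₁ (P₂ t) t := fun t =>
    (((hasDerivAt_hatPrimDeriv _).comp_add_const t T).sub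
      (((hasDerivAt_hatPrimDeriv _).comp_add_const t 3).const_mul _)).add
      (((hasDerivAt_hatPrimDeriv _).comp_add_const t 2).const_mul _)
  have hPc : ContDiff ℝ 2 P := by
    refine contDiff_two_of_hasDerivAt d1 d2 ?_
    have := continuous_hat
    fun_prop
  have ha : ∀ t ≤ -1 - T, P t = 0 := fun t ht => by
    simp only [hP]
    rw [hatPrim_eq_zero (by linarith), hatPrim_eq_zero (by linarith),
      hatPrim_eq_zero (by linarith)]
    ring
  have hb : ∀ t, -1 ≤ t → P t = 0 := fun t ht => by
    simp only [hP]
    rw [hatPrim_eq_self (by linarith), hatPrim_eq_self (by linarith),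
      hatPrim_eq_self (by linarith)]
    ring
  have hbd : ∀ t, |P t| ≤ 6 * T := fun t => by
    rcases le_or_gt (-1) t with h | h
    · rw [hb t h, abs_zero]
      linarith
    have e1 := hatPrim_le (t := t + T) (b := T) (by linarith) (by linarith)
    have e2 := hatPrim_le (t := t + 3) (b := 3) (by linarith) (by linarith)
    have e3 := hatPrim_le (t := t + 2) (b := 2) (by linarith) (by linarith)
    have n1 := hatPrim_nonneg (t + T)
    have n2 := hatPrim_nonneg (t + 3)
    have n3 := hatPrim_nonneg (t + 2)
    simp only [hP]
    rw [abs_le]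
    constructor <;> nlinarith
  have green := integral_mul_lapl_eq isOpen_punctured hu (contDiff_radial hPc ha hb)
    (hasCompactSupport_radial ha hb)
    ((tsupport_radial_subset ha hb).trans annulus_subset_punctured)
  have hae : ∀ᵐ w : ℂ, w ≠ 0 := by simp [ae_iff, measure_singleton]
  have huc := hu.continuousOn
  have rhs : ∫ w, lapl (fun w : ℂ => P (Real.log ‖w‖)) w * u w
      = H T - (T - 2) * H 3 + (T - 3) * H 2 := by
    simp only [hH]
    rw [← integral_const_mul, ← integral_const_mul, ← integral_sub, ← integral_add]
    · refine integral_congr_ae ?_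
      filter_upwards [hae] with w hw
      rw [lapl_radial d1 d2 hw]
      simp only [hP₂]
      ring
    · exact (integrable_hat_mul huc (by linarith)).sub
        ((integrable_hat_mul huc (by norm_num)).const_mul _)
    · exact (integrable_hat_mul huc (by norm_num)).const_mul _
    · exact integrable_hat_mul huc (by linarith)
    · exact (integrable_hat_mul huc (by norm_num)).const_mul _
  have lhs : |∫ w, P (Real.log ‖w‖) * lapl u w| ≤ 6 * T * F := by
    have hz : ∀ w ∉ Ω, P (Real.log ‖w‖) * lapl u w = 0 := fun w hw => by
      have : P (Real.log ‖w‖) = 0 := by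
        by_contra h
        exact hw (annulus_subset_punctured (tsupport_radial_subset ha hb (subset_tsupport _ h)))
      rw [this, zero_mul]
    rw [← setIntegral_eq_integral_of_forall_compl_eq_zero hz, ← Real.norm_eq_abs,
      ← integral_const_mul]
    refine norm_integral_le_of_norm_le (hf.abs.const_mul _) (ae_of_all _ fun w => ?_)
    rw [norm_mul]
    exact mul_le_mul_of_nonneg_right (hbd _) (norm_nonneg _)
  rw [green, rhs] at lhs
  have l1 := (abs_le.1 lhs).1
  have l2 := neg_abs_le (H 3)
  have l3 := le_abs_self (H 2)
  have l4 := abs_nonneg (H 3)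
  have l5 := abs_nonneg (H 2)
  change -H T ≤ _
  nlinarith

/-- Logarithmic-scale `L¹` bound near the puncture. -/
lemma integral_hat_abs_le {u : ℂ → ℝ} (hu : ContDiffOn ℝ 2 u (ball (0 : ℂ) 1 \ {0}))
    (hf : IntegrableOn (lapl u) (ball (0 : ℂ) 1 \ {0}))
    (he : IntegrableOn (fun w => Real.exp (2 * u w)) (ball (0 : ℂ) 1 \ {0})) :
    ∃ C, 0 ≤ C ∧ ∀ T, 3 ≤ T →
      ∫ w, hat (Real.log ‖w‖ + T) / ‖w‖ ^ 2 * |u w| ≤ C * T := by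
  obtain ⟨C, hC, hCb⟩ := neg_integral_hat_le hu hf
  set Ω := ball (0 : ℂ) 1 \ {0} with hΩ
  set E : ℝ := ∫ w in Ω, Real.exp (2 * u w)
  have hE : 0 ≤ E := integral_nonneg fun _ => (Real.exp_pos _).le
  refine ⟨C + Real.exp 2 * E + 2 * Real.pi * Real.exp 4, by positivity, fun T hT => ?_⟩
  have huc := hu.continuousOn
  set B := ball (0 : ℂ) (Real.exp (1 - T)) with hB
  have iA := integrable_hat_mul huc.abs (a := T) (by linarith)
  have iU := integrable_hat_mul huc (a := T) (by linarith)
  have i1 : Integrable (Ω.indicator fun w => Real.exp 2 * Real.exp (2 * u w)) :=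
    (integrable_indicator_iff isOpen_punctured.measurableSet).2 (he.const_mul _)
  have hBfin : volume B ≠ ⊤ := measure_ball_lt_top.ne
  have i2 : Integrable (B.indicator fun _ => 2 * T * Real.exp (2 + 2 * T)) :=
    (integrable_indicator_iff measurableSet_ball).2 (integrableOn_const hBfin)
  have hpt : ∀ w, hat (Real.log ‖w‖ + T) / ‖w‖ ^ 2 * |u w| ≤
      (Ω.indicator (fun w => Real.exp 2 * Real.exp (2 * u w)) w
        + B.indicator (fun _ => 2 * T * Real.exp (2 + 2 * T)) w)
      - hat (Real.log ‖w‖ + T) / ‖w‖ ^ 2 * u w := by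
    intro w
    have n1 : 0 ≤ Ω.indicator (fun w => Real.exp 2 * Real.exp (2 * u w)) w :=
      indicator_nonneg (fun _ _ => by positivity) _
    have n2 : 0 ≤ B.indicator (fun _ => 2 * T * Real.exp (2 + 2 * T)) w :=
      indicator_nonneg (fun _ _ => by positivity) _
    rcases eq_or_ne w 0 with rfl | h0
    · simpa using add_nonneg n1 n2
    by_cases hz : hat (Real.log ‖w‖ + T) = 0
    · simpa [hz] using add_nonneg n1 n2
    have hp : 0 < ‖w‖ := norm_pos_iff.2 h0
    have hlt : |Real.log ‖w‖ + T| < 1 := by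
      by_contra! h'
      exact hz (hat_eq_zero h')
    rw [abs_lt] at hlt
    have hwB : w ∈ B := by
      rw [hB, mem_ball_zero_iff, ← Real.log_lt_iff_lt_exp hp]
      linarith
    have hwΩ : w ∈ Ω := by
      refine ⟨ball_subset_ball ?_ hwB, by simpa using h0⟩
      rw [Real.exp_le_one_iff]
      linarith
    rw [indicator_of_mem hwΩ, indicator_of_mem hwB]
    have hk : hat (Real.log ‖w‖ + T) / ‖w‖ ^ 2 ≤ Real.exp (2 + 2 * T) := by
      have h3 : Real.exp (-1 - T) ≤ ‖w‖ := by
        rw [← Real.le_log_iff_exp_le hp]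
        linarith
      have h4 : Real.exp (2 + 2 * T) * Real.exp (-1 - T) ^ 2 = 1 := by
        rw [← Real.exp_nat_mul, ← Real.exp_add]
        simp only [Nat.cast_ofNat, Real.exp_eq_one_iff]
        ring
      rw [div_le_iff₀ (by positivity)]
      calc hat (Real.log ‖w‖ + T) ≤ 1 := hat_le_one _
        _ = Real.exp (2 + 2 * T) * Real.exp (-1 - T) ^ 2 := h4.symm
        _ ≤ _ := by gcongr
    have hk0 : 0 ≤ hat (Real.log ‖w‖ + T) / ‖w‖ ^ 2 := div_nonneg (hat_nonneg _) (by positivity)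
    have hu2 : |u w| + u w ≤ Real.exp (-(2 * T)) * Real.exp (2 * u w) + 2 * T := by
      rcases le_or_gt (u w) 0 with h | h
      · rw [abs_of_nonpos h]
        have : 0 ≤ Real.exp (-(2 * T)) * Real.exp (2 * u w) := by positivity
        linarith
      · rw [abs_of_pos h, ← Real.exp_add]
        have := Real.add_one_le_exp (-(2 * T) + 2 * u w)
        linarith
    have hs : 0 ≤ |u w| + u w := by linarith [neg_abs_le (u w)]
    have hm := mul_le_mul hk hu2 hs (Real.exp_pos _).le
    have h5 : Real.exp (2 + 2 * T) * Real.exp (-(2 * T)) = Real.exp 2 := by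
      rw [← Real.exp_add]
      ring_nf
    have h6 : Real.exp (2 + 2 * T) * (Real.exp (-(2 * T)) * Real.exp (2 * u w) + 2 * T)
        = Real.exp 2 * Real.exp (2 * u w) + 2 * T * Real.exp (2 + 2 * T) := by
      rw [mul_add, ← mul_assoc, h5]
      ring
    rw [h6] at hm
    linarith
  have i12 : Integrable fun w => Ω.indicator (fun w => Real.exp 2 * Real.exp (2 * u w)) w
      + B.indicator (fun _ => 2 * T * Real.exp (2 + 2 * T)) w := i1.add i2
  have i3 : Integrable fun w => (Ω.indicator (fun w => Real.exp 2 * Real.exp (2 * u w)) w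
      + B.indicator (fun _ => 2 * T * Real.exp (2 + 2 * T)) w)
      - hat (Real.log ‖w‖ + T) / ‖w‖ ^ 2 * u w := i12.sub iU
  have hint := integral_mono iA i3 hpt
  have heq : ∫ w, ((Ω.indicator (fun w => Real.exp 2 * Real.exp (2 * u w)) w
        + B.indicator (fun _ => 2 * T * Real.exp (2 + 2 * T)) w)
      - hat (Real.log ‖w‖ + T) / ‖w‖ ^ 2 * u w)
      = Real.exp 2 * E + 2 * Real.pi * Real.exp 4 * T
        - ∫ w, hat (Real.log ‖w‖ + T) / ‖w‖ ^ 2 * u w := by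
    rw [integral_sub i12 iU, integral_add i1 i2,
      integral_indicator isOpen_punctured.measurableSet, integral_indicator measurableSet_ball,
      integral_const_mul, setIntegral_const]
    congr 2
    rw [measureReal_def, Complex.volume_ball, ENNReal.toReal_mul, ENNReal.toReal_pow,
      ENNReal.toReal_ofReal (Real.exp_pos _).le, ENNReal.coe_toReal, NNReal.coe_real_pi, smul_eq_mul]
    have : Real.exp (1 - T) ^ 2 * Real.exp (2 + 2 * T) = Real.exp 4 := by
      rw [← Real.exp_nat_mul, ← Real.exp_add]
      push_cast
      ring_nf
    linear_combination 2 * Real.pi * T * this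
  refine hint.trans ?_
  rw [heq]
  have := hCb T hT
  have h7 : 0 ≤ Real.exp 2 * E := by positivity
  nlinarith

end Estimates

section Cutoff

lemma exists_radial_cutoff : ∃ (s s₁ s₂ : ℝ → ℝ) (C : ℝ), (∀ t, HasDerivAt s (s₁ t) t) ∧
    (∀ t, HasDerivAt s₁ (s₂ t) t) ∧ Continuous s₁ ∧ Continuous s₂ ∧ (∀ t, 0 ≤ s t) ∧
    (∀ t, s t ≤ 1) ∧ (∀ t ≤ 0, s t = 0) ∧ (∀ t, 1 ≤ t → s t = 1) ∧
    (∀ t, s₁ t ≠ 0 → 0 ≤ t ∧ t ≤ 1) ∧ (∀ t, s₂ t ≠ 0 → 0 ≤ t ∧ t ≤ 1) ∧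
    (∀ t, |s₁ t| ≤ C) ∧ (∀ t, |s₂ t| ≤ C) := by
  have h2 : ContDiff ℝ 2 Real.smoothTransition := Real.smoothTransition.contDiff
  have h1 : ContDiff ℝ 1 (deriv Real.smoothTransition) :=
    (contDiff_succ_iff_deriv.1 (by simpa [one_add_one_eq_two] using h2 : ContDiff ℝ (1 + 1) _)).2.2
  have c2 : Continuous (deriv (deriv Real.smoothTransition)) := h1.continuous_deriv le_rfl
  have z1 : ∀ t : ℝ, t < 0 ∨ 1 < t → deriv Real.smoothTransition =ᶠ[𝓝 t] fun _ => 0 := by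
    rintro t (ht | ht)
    · filter_upwards [gt_mem_nhds ht] with s hs
      have : Real.smoothTransition =ᶠ[𝓝 s] fun _ => 0 := by
        filter_upwards [gt_mem_nhds hs] with r hr using Real.smoothTransition.zero_of_nonpos hr.le
      rw [this.deriv_eq, deriv_const]
    · filter_upwards [lt_mem_nhds ht] with s hs
      have : Real.smoothTransition =ᶠ[𝓝 s] fun _ => 1 := by
        filter_upwards [lt_mem_nhds hs] with r hr using Real.smoothTransition.one_of_one_le hr.le
      rw [this.deriv_eq, deriv_const]
  have n1 : ∀ t, deriv Real.smoothTransition t ≠ 0 → 0 ≤ t ∧ t ≤ 1 := fun t ht => by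
    by_contra! h
    refine ht ((z1 t ?_).self_of_nhds)
    by_cases h0 : 0 ≤ t
    · exact Or.inr (h h0)
    · exact Or.inl (not_le.1 h0)
  have n2 : ∀ t, deriv (deriv Real.smoothTransition) t ≠ 0 → 0 ≤ t ∧ t ≤ 1 := fun t ht => by
    by_contra! h
    refine ht ?_
    rw [(z1 t ?_).deriv_eq, deriv_const]
    by_cases h0 : 0 ≤ t
    · exact Or.inr (h h0)
    · exact Or.inl (not_le.1 h0)
  obtain ⟨C₁, hC₁⟩ := h1.continuous.bounded_above_of_compact_support
    (HasCompactSupport.of_support_subset_isCompact isCompact_Icc fun t ht => n1 t ht)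
  obtain ⟨C₂, hC₂⟩ := c2.bounded_above_of_compact_support
    (HasCompactSupport.of_support_subset_isCompact isCompact_Icc fun t ht => n2 t ht)
  exact ⟨Real.smoothTransition, deriv Real.smoothTransition, deriv (deriv Real.smoothTransition),
    max C₁ C₂, fun t => (h2.differentiable (by norm_num) t).hasDerivAt,
    fun t => (h1.differentiable (by norm_num) t).hasDerivAt, h1.continuous, c2,
    Real.smoothTransition.nonneg, Real.smoothTransition.le_one,
    fun t ht => Real.smoothTransition.zero_of_nonpos ht,
    fun t ht => Real.smoothTransition.one_of_one_le ht, n1, n2,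
    fun t => (hC₁ t).trans (le_max_left _ _), fun t => (hC₂ t).trans (le_max_right _ _)⟩

end Cutoff

section LogPotential

lemma abs_log_sub_le {x y c : ℝ} (hc : 0 < c) (hx : c ≤ x) (hy : c ≤ y) :
    |Real.log x - Real.log y| ≤ |x - y| / c := by
  have key : ∀ {x y : ℝ}, c ≤ x → c ≤ y → Real.log x - Real.log y ≤ |x - y| / c := by
    intro x y hx hy
    have hx0 := hc.trans_le hx
    have hy0 := hc.trans_le hy
    rw [← Real.log_div hx0.ne' hy0.ne']
    calc Real.log (x / y) ≤ x / y - 1 := Real.log_le_sub_one_of_pos (by positivity)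
      _ = (x - y) / y := by field_simp
      _ ≤ |x - y| / y := by gcongr; exact le_abs_self _
      _ ≤ |x - y| / c := by gcongr
  rw [abs_le]
  constructor
  · have := key hy hx
    rw [abs_sub_comm] at this
    linarith
  · exact key hx hy

/-- Logarithmic potentials of continuous densities on a bounded open set converge. -/
lemma integrable_log_norm_sub_mul_indicator {Ω : Set ℂ} (hΩ : IsOpen Ω)
    (hsub : Ω ⊆ ball (0 : ℂ) 1) {f : ℂ → ℝ}
    (hf : ContinuousOn f Ω) (hi : IntegrableOn f Ω) {z : ℂ} (hz : z ∈ Ω) :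
    Integrable fun w => Real.log ‖w - z‖ * Ω.indicator f w := by
  obtain ⟨δ, hδ, hball⟩ := Metric.nhds_basis_closedBall.mem_iff.1 (hΩ.mem_nhds hz)
  obtain ⟨K, hK⟩ := (isCompact_closedBall z δ).exists_bound_of_continuousOn (hf.mono hball)
  have i1 : Integrable ((closedBall z δ).indicator fun w => K * (‖w - z‖ + ‖w - z‖⁻¹)) := by
    refine (integrable_indicator_iff measurableSet_closedBall).2 (Integrable.const_mul ?_ _)
    refine Integrable.add ?_
      ((locallyIntegrable_inv_norm_sub z).integrableOn_isCompact (isCompact_closedBall z δ))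
    exact (by fun_prop : Continuous fun w => ‖w - z‖).continuousOn.integrableOn_compact
      (isCompact_closedBall z δ)
  have i2 : Integrable (Ω.indicator f) := (integrable_indicator_iff hΩ.measurableSet).2 hi
  have i3 : Integrable fun w => (2 + δ⁻¹) * |Ω.indicator f w| := i2.abs.const_mul _
  refine (i1.add i3).mono' ?_ (ae_of_all _ fun w => ?_)
  · exact (by fun_prop : Measurable fun w => Real.log ‖w - z‖).aestronglyMeasurable.mul
      i2.aestronglyMeasurable
  have n3 : 0 ≤ (2 + δ⁻¹) * |Ω.indicator f w| := by positivity
  rw [Real.norm_eq_abs, abs_mul, Pi.add_apply]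
  by_cases hw : w ∈ closedBall z δ
  · rw [indicator_of_mem hw, indicator_of_mem (hball hw)]
    rw [indicator_of_mem (hball hw)] at n3
    have hl : |Real.log ‖w - z‖| ≤ ‖w - z‖ + ‖w - z‖⁻¹ := by
      rcases eq_or_ne w z with rfl | h
      · simp
      · exact abs_log_le_add_inv (norm_pos_iff.2 (sub_ne_zero.2 h))
    have hb := hK w hw
    rw [Real.norm_eq_abs] at hb
    have := mul_le_mul hl hb (abs_nonneg _) (by positivity)
    linarith
  · rw [indicator_of_notMem hw, zero_add]
    by_cases hwΩ : w ∈ Ω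
    · rw [mem_closedBall, not_le, dist_eq_norm] at hw
      have h0 := hδ.trans hw
      have h1 := mem_ball_zero_iff.1 (hsub hwΩ)
      have h2 := mem_ball_zero_iff.1 (hsub hz)
      have h3 := norm_sub_le w z
      gcongr
      refine (abs_log_le_add_inv h0).trans (add_le_add (by linarith) ?_)
      gcongr
    · simp [indicator_of_notMem hwΩ]

/-- The error density produced by a radial cutoff with first and second logarithmic
derivatives `s₁`, `s₂`. -/
noncomputable def edgeKernel (s₁ s₂ : ℝ → ℝ) (u : ℂ → ℝ) (a : ℝ) (z w : ℂ) : ℝ :=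
  Real.log ‖w - z‖ * (s₂ (Real.log ‖w‖ + a) / ‖w‖ ^ 2 * u w)
    + 2 * (s₁ (Real.log ‖w‖ + a) / ‖w‖ ^ 2 * inner ℝ w (w - z) * u w / ‖w - z‖ ^ 2)

lemma integrable_shift_radial_mul {s : ℝ → ℝ} (hs : Continuous s)
    (hs0 : ∀ t, s t ≠ 0 → 0 ≤ t ∧ t ≤ 1) {a : ℝ} {g : ℂ → ℝ}
    (hg : ContinuousOn g (annulus (-a) (1 - a))) :
    Integrable fun w => s (Real.log ‖w‖ + a) / ‖w‖ ^ 2 * g w :=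
  integrable_radial_mul (p := fun t => s (t + a)) (hs.comp (by fun_prop))
    (fun t ht => ⟨by linarith [(hs0 _ ht).1], by linarith [(hs0 _ ht).2]⟩) hg

lemma integrable_edgeKernel {s₁ s₂ : ℝ → ℝ} (c1 : Continuous s₁) (c2 : Continuous s₂)
    (h1 : ∀ t, s₁ t ≠ 0 → 0 ≤ t ∧ t ≤ 1) (h2 : ∀ t, s₂ t ≠ 0 → 0 ≤ t ∧ t ≤ 1) {u : ℂ → ℝ} {a : ℝ}
    {z : ℂ} (hu : ContinuousOn u (annulus (-a) (1 - a))) (hz : z ∉ annulus (-a) (1 - a)) :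
    Integrable (edgeKernel s₁ s₂ u a z) := by
  have hn : ∀ w ∈ annulus (-a) (1 - a), ‖w - z‖ ≠ 0 := fun w hw => by
    rw [norm_ne_zero_iff, sub_ne_zero]
    rintro rfl
    exact hz hw
  have hlog : ContinuousOn (fun w => Real.log ‖w - z‖) (annulus (-a) (1 - a)) :=
    ContinuousOn.log (by fun_prop) hn
  have i1 := integrable_shift_radial_mul c2 h2 (hlog.mul hu)
  have i2 := integrable_shift_radial_mul c1 h1 (g := fun w => inner ℝ w (w - z) * u w / ‖w - z‖ ^ 2)
    (ContinuousOn.div (ContinuousOn.mul (by fun_prop) hu) (by fun_prop)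
      fun w hw => pow_ne_zero 2 (hn w hw))
  refine (i1.add (i2.const_mul 2)).congr (ae_of_all _ fun w => ?_)
  simp only [edgeKernel, Pi.add_apply, Pi.mul_apply]
  ring

end LogPotential

section Cutoff

/-- A radial transition function with its first two derivatives. -/
structure RadialCutoff where
  /-- the transition function -/
  s : ℝ → ℝ
  /-- its derivative -/
  s₁ : ℝ → ℝ
  /-- its second derivative -/
  s₂ : ℝ → ℝ
  /-- a bound for both derivatives -/
  C : ℝ
  hasDerivAt_s : ∀ t, HasDerivAt s (s₁ t) t
  hasDerivAt_s₁ : ∀ t, HasDerivAt s₁ (s₂ t) t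
  continuous_s₁ : Continuous s₁
  continuous_s₂ : Continuous s₂
  nonneg : ∀ t, 0 ≤ s t
  le_one : ∀ t, s t ≤ 1
  eq_zero : ∀ t ≤ 0, s t = 0
  eq_one : ∀ t, 1 ≤ t → s t = 1
  supp₁ : ∀ t, s₁ t ≠ 0 → 0 ≤ t ∧ t ≤ 1
  supp₂ : ∀ t, s₂ t ≠ 0 → 0 ≤ t ∧ t ≤ 1
  bound₁ : ∀ t, |s₁ t| ≤ C
  bound₂ : ∀ t, |s₂ t| ≤ C

lemma nonempty_radialCutoff : Nonempty RadialCutoff := by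
  obtain ⟨s, s₁, s₂, C, h⟩ := exists_radial_cutoff
  obtain ⟨a, b, c, d, e, f, g, h, i, j, k, l⟩ := h
  exact ⟨⟨s, s₁, s₂, C, a, b, c, d, e, f, g, h, i, j, k, l⟩⟩

end Cutoff

section Expansion

variable (R : RadialCutoff) {u : ℂ → ℝ}

lemma notMem_annulus_of_norm_lt {a b : ℝ} {z : ℂ} (h : ‖z‖ < Real.exp a) : z ∉ annulus a b :=
  fun h' => absurd (mem_annulus.1 h').1 (not_le.2 h)

lemma notMem_annulus_of_lt_norm {a b : ℝ} {z : ℂ} (h : Real.exp b < ‖z‖) : z ∉ annulus a b :=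
  fun h' => absurd (mem_annulus.1 h').2 (not_le.2 h)

/-- The representation formula for the annular cutoff. -/
lemma annular_representation (hu : ContDiffOn ℝ 2 u (ball (0 : ℂ) 1 \ {0})) {z : ℂ}
    (hz0 : z ≠ 0) (hz : ‖z‖ < Real.exp (-3)) {a : ℝ}
    (haz : 1 - a < Real.log ‖z‖) :
    ∫ w, Real.log ‖w - z‖ * ((R.s (Real.log ‖w‖ + a) - R.s (Real.log ‖w‖ + 2)) * lapl u w)
      = logMass * u z + ((∫ w, edgeKernel R.s₁ R.s₂ u a z w)
        - ∫ w, edgeKernel R.s₁ R.s₂ u 2 z w) := by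
  have hp : 0 < ‖z‖ := norm_pos_iff.2 hz0
  have hl : Real.log ‖z‖ < -3 := (Real.log_lt_iff_lt_exp hp).2 hz
  set P : ℝ → ℝ := fun t => R.s (t + a) - R.s (t + 2) with hP
  have d1 : ∀ t, HasDerivAt P (R.s₁ (t + a) - R.s₁ (t + 2)) t := fun t =>
    ((R.hasDerivAt_s _).comp_add_const t a).sub ((R.hasDerivAt_s _).comp_add_const t 2)
  have d2 : ∀ t, HasDerivAt (fun t => R.s₁ (t + a) - R.s₁ (t + 2))
      (R.s₂ (t + a) - R.s₂ (t + 2)) t := fun t =>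
    ((R.hasDerivAt_s₁ _).comp_add_const t a).sub ((R.hasDerivAt_s₁ _).comp_add_const t 2)
  have hPc : ContDiff ℝ 2 P := by
    refine contDiff_two_of_hasDerivAt d1 d2 ?_
    have := R.continuous_s₂
    fun_prop
  have h0 : ∀ t ≤ -a, P t = 0 := fun t ht => by
    simp only [hP]
    rw [R.eq_zero _ (by linarith), R.eq_zero _ (by linarith), sub_zero]
  have h1 : ∀ t, -1 ≤ t → P t = 0 := fun t ht => by
    simp only [hP]
    rw [R.eq_one _ (by linarith), R.eq_one _ (by linarith), sub_self]
  have huc := hu.continuousOn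
  have rep := lapl_representation isOpen_punctured hu (contDiff_radial hPc h0 h1)
    (hasCompactSupport_radial h0 h1)
    ((tsupport_radial_subset h0 h1).trans annulus_subset_punctured) z
  have hPz : P (Real.log ‖z‖) = 1 := by
    simp only [hP]
    rw [R.eq_one _ (by linarith), R.eq_zero _ (by linarith), sub_zero]
  rw [hPz, one_mul] at rep
  rw [rep, ← integral_sub]
  · congr 1
    have hae : ∀ᵐ w : ℂ, w ≠ 0 := by simp [ae_iff, measure_singleton]
    refine integral_congr_ae ?_
    filter_upwards [hae] with w hw
    rw [lapl_radial d1 d2 hw, fderiv_radial d1 hw]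
    simp only [edgeKernel]
    ring
  · refine integrable_edgeKernel R.continuous_s₁ R.continuous_s₂ R.supp₁ R.supp₂
      (huc.mono (annulus_subset (by linarith))) (notMem_annulus_of_lt_norm ?_)
    rwa [← Real.lt_log_iff_exp_lt hp]
  · refine integrable_edgeKernel R.continuous_s₁ R.continuous_s₂ R.supp₁ R.supp₂
      (huc.mono (annulus_subset (by linarith))) (notMem_annulus_of_norm_lt ?_)
    exact hz.trans (Real.exp_lt_exp.2 (by norm_num))

/-- The cut-off Laplacian. -/
noncomputable def cutLapl (R : RadialCutoff) (u : ℂ → ℝ) : ℂ → ℝ :=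
  (ball (0 : ℂ) 1 \ {0}).indicator fun w => (1 - R.s (Real.log ‖w‖ + 2)) * lapl u w

lemma continuousOn_cutLapl_density (hu : ContDiffOn ℝ 2 u (ball (0 : ℂ) 1 \ {0})) :
    ContinuousOn (fun w => (1 - R.s (Real.log ‖w‖ + 2)) * lapl u w) (ball (0 : ℂ) 1 \ {0}) := by
  have hs : Continuous R.s := continuous_iff_continuousAt.2 fun t => (R.hasDerivAt_s t).continuousAt
  refine ContinuousOn.mul ?_ (continuousOn_lapl isOpen_punctured hu)
  refine continuousOn_const.sub (hs.comp_continuousOn ?_)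
  refine ContinuousOn.add (ContinuousOn.log (by fun_prop) fun w hw => ?_) continuousOn_const
  exact norm_ne_zero_iff.2 (by simpa using hw.2)

lemma tendsto_integral_annular (hu : ContDiffOn ℝ 2 u (ball (0 : ℂ) 1 \ {0}))
    (hf : IntegrableOn (lapl u) (ball (0 : ℂ) 1 \ {0})) {z : ℂ} (hz : z ∈ ball (0 : ℂ) 1 \ {0}) :
    Tendsto (fun a : ℝ => ∫ w, Real.log ‖w - z‖
      * ((R.s (Real.log ‖w‖ + a) - R.s (Real.log ‖w‖ + 2)) * lapl u w)) atTop
      (𝓝 (∫ w, Real.log ‖w - z‖ * cutLapl R u w)) := by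
  have hs : Continuous R.s := continuous_iff_continuousAt.2 fun t => (R.hasDerivAt_s t).continuousAt
  have hΩ := isOpen_punctured.measurableSet
  have hlc := continuousOn_lapl isOpen_punctured hu
  have hb := integrable_log_norm_sub_mul_indicator isOpen_punctured sdiff_subset hlc hf hz
  have hae : ∀ᵐ w : ℂ, w ≠ 0 := by simp [ae_iff, measure_singleton]
  have hout : ∀ w : ℂ, w ≠ 0 → w ∉ ball (0 : ℂ) 1 \ {0} → 0 ≤ Real.log ‖w‖ := fun w h0 hw => by
    refine Real.log_nonneg ?_
    by_contra! h
    exact hw ⟨by simpa using h, by simpa using h0⟩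
  have heq : ∀ a : ℝ, 2 ≤ a → ∀ w : ℂ, w ≠ 0 →
      (R.s (Real.log ‖w‖ + a) - R.s (Real.log ‖w‖ + 2)) * lapl u w
        = (R.s (Real.log ‖w‖ + a) - R.s (Real.log ‖w‖ + 2))
          * (ball (0 : ℂ) 1 \ {0}).indicator (lapl u) w := fun a ha w h0 => by
    by_cases hw : w ∈ ball (0 : ℂ) 1 \ {0}
    · rw [indicator_of_mem hw]
    · have := hout w h0 hw
      rw [R.eq_one _ (by linarith), R.eq_one _ (by linarith)]
      simp
  have iΩ : Integrable ((ball (0 : ℂ) 1 \ {0}).indicator (lapl u)) :=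
    (integrable_indicator_iff hΩ).2 hf
  refine tendsto_integral_filter_of_dominated_convergence _ ?_ ?_ hb.abs ?_
  · filter_upwards [eventually_ge_atTop 2] with a ha
    have hm : Measurable fun w : ℂ => R.s (Real.log ‖w‖ + a) - R.s (Real.log ‖w‖ + 2) := by
      have := hs.measurable
      fun_prop
    have hl : Measurable fun w : ℂ => Real.log ‖w - z‖ := by fun_prop
    refine (hl.aestronglyMeasurable.mul
      (hm.aestronglyMeasurable.mul iΩ.aestronglyMeasurable)).congr ?_
    filter_upwards [hae] with w hw
    simp only [Pi.mul_apply]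
    rw [heq a ha w hw]
  · filter_upwards [eventually_ge_atTop 2] with a ha
    filter_upwards [hae] with w hw
    rw [heq a ha w hw, Real.norm_eq_abs, abs_mul, abs_mul, abs_mul]
    refine mul_le_mul_of_nonneg_left (mul_le_of_le_one_left (abs_nonneg _) ?_) (abs_nonneg _)
    have a1 := R.nonneg (Real.log ‖w‖ + a)
    have a2 := R.nonneg (Real.log ‖w‖ + 2)
    have a3 := R.le_one (Real.log ‖w‖ + a)
    have a4 := R.le_one (Real.log ‖w‖ + 2)
    rw [abs_le]
    constructor <;> linarith
  · filter_upwards [hae] with w hw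
    refine tendsto_const_nhds.congr' ?_
    filter_upwards [eventually_ge_atTop 2, eventually_ge_atTop (1 - Real.log ‖w‖)] with a ha ha'
    rw [heq a ha w hw, R.eq_one _ (by linarith), cutLapl]
    by_cases hwΩ : w ∈ ball (0 : ℂ) 1 \ {0}
    · rw [indicator_of_mem hwΩ, indicator_of_mem hwΩ]
    · rw [indicator_of_notMem hwΩ, indicator_of_notMem hwΩ, mul_zero, mul_zero, mul_zero]

/-- The inner edge contributes a multiple of `log ‖z‖` up to a vanishing error. -/
lemma tendsto_integral_edgeKernel_sub (hu : ContDiffOn ℝ 2 u (ball (0 : ℂ) 1 \ {0}))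
    (hf : IntegrableOn (lapl u) (ball (0 : ℂ) 1 \ {0}))
    (he : IntegrableOn (fun w => Real.exp (2 * u w)) (ball (0 : ℂ) 1 \ {0})) {z : ℂ}
    (hz0 : z ≠ 0) :
    Tendsto (fun T : ℝ => (∫ w, edgeKernel R.s₁ R.s₂ u (T + 1 / 2) z w)
      - Real.log ‖z‖ * ∫ w, R.s₂ (Real.log ‖w‖ + (T + 1 / 2)) / ‖w‖ ^ 2 * u w) atTop (𝓝 0) := by
  obtain ⟨C, hC, hCb⟩ := integral_hat_abs_le hu hf he
  have hp : 0 < ‖z‖ := norm_pos_iff.2 hz0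
  have huc := hu.continuousOn
  have hRC : 0 ≤ R.C := (abs_nonneg _).trans (R.bound₁ 0)
  have hlim : Tendsto (fun T : ℝ => 12 * R.C / ‖z‖ * Real.exp (1 / 2) * C * (T ^ 1 * Real.exp (-T)))
      atTop (𝓝 0) := by
    simpa using (Real.tendsto_pow_mul_exp_neg_atTop_nhds_zero 1).const_mul
      (12 * R.C / ‖z‖ * Real.exp (1 / 2) * C)
  refine squeeze_zero_norm' ?_ hlim
  have hsmall : ∀ᶠ T : ℝ in atTop, Real.exp (1 / 2 - T) < ‖z‖ / 2 := by
    have : Tendsto (fun T : ℝ => Real.exp (1 / 2 - T)) atTop (𝓝 0) :=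
      Real.tendsto_exp_atBot.comp (tendsto_atBot_add_const_left _ (1 / 2) tendsto_neg_atTop_atBot)
    exact this.eventually_lt_const (by positivity)
  filter_upwards [eventually_ge_atTop 3, hsmall] with T hT hTz
  have hsubu : ContinuousOn u (annulus (-(T + 1 / 2)) (1 - (T + 1 / 2))) :=
    huc.mono (annulus_subset (by linarith))
  have iE : Integrable (edgeKernel R.s₁ R.s₂ u (T + 1 / 2) z) := by
    refine integrable_edgeKernel R.continuous_s₁ R.continuous_s₂ R.supp₁ R.supp₂ hsubu
      (notMem_annulus_of_lt_norm ?_)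
    have : 1 - (T + 1 / 2) = 1 / 2 - T := by ring
    rw [this]
    linarith
  have iI := integrable_shift_radial_mul R.continuous_s₂ R.supp₂ hsubu
  rw [← integral_const_mul, ← integral_sub iE (iI.const_mul _)]
  have iA := integrable_hat_mul huc.abs (a := T) (by linarith)
  have hbound : ∀ w, ‖edgeKernel R.s₁ R.s₂ u (T + 1 / 2) z w
      - Real.log ‖z‖ * (R.s₂ (Real.log ‖w‖ + (T + 1 / 2)) / ‖w‖ ^ 2 * u w)‖
      ≤ 12 * R.C / ‖z‖ * Real.exp (1 / 2 - T) * (hat (Real.log ‖w‖ + T) / ‖w‖ ^ 2 * |u w|) := by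
    intro w
    have hK : 0 ≤ 12 * R.C / ‖z‖ * Real.exp (1 / 2 - T) := by positivity
    have hh : 0 ≤ hat (Real.log ‖w‖ + T) / ‖w‖ ^ 2 * |u w| :=
      mul_nonneg (div_nonneg (hat_nonneg _) (by positivity)) (abs_nonneg _)
    rcases eq_or_ne w 0 with rfl | h0
    · simp [edgeKernel]
    have hw : 0 < ‖w‖ := norm_pos_iff.2 h0
    by_cases hin : 0 ≤ Real.log ‖w‖ + (T + 1 / 2) ∧ Real.log ‖w‖ + (T + 1 / 2) ≤ 1
    swap
    · have e1 : R.s₁ (Real.log ‖w‖ + (T + 1 / 2)) = 0 := by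
        by_contra h
        exact hin (R.supp₁ _ h)
      have e2 : R.s₂ (Real.log ‖w‖ + (T + 1 / 2)) = 0 := by
        by_contra h
        exact hin (R.supp₂ _ h)
      refine le_trans (le_of_eq ?_) (mul_nonneg hK hh)
      simp only [edgeKernel, e1, e2]
      simp
    have hhat : 1 / 2 ≤ hat (Real.log ‖w‖ + T) :=
      half_le_hat (abs_le.2 ⟨by linarith [hin.1], by linarith [hin.2]⟩)
    have hwle : ‖w‖ ≤ Real.exp (1 / 2 - T) :=
      (Real.log_le_iff_le_exp hw).1 (by linarith [hin.2])
    have hd : ‖z‖ / 2 ≤ ‖w - z‖ := by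
      have := norm_sub_norm_le z w
      rw [norm_sub_rev] at this
      linarith
    have hd0 : 0 < ‖w - z‖ := lt_of_lt_of_le (by positivity) hd
    have hlog : |Real.log ‖w - z‖ - Real.log ‖z‖| ≤ 2 * ‖w‖ / ‖z‖ := by
      refine (abs_log_sub_le (c := ‖z‖ / 2) (by positivity) hd (by linarith)).trans ?_
      have : |‖w - z‖ - ‖z‖| ≤ ‖w‖ := by
        have := abs_norm_sub_norm_le (w - z) (-z)
        simpa using this
      calc |‖w - z‖ - ‖z‖| / (‖z‖ / 2) ≤ ‖w‖ / (‖z‖ / 2) := by gcongr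
        _ = 2 * ‖w‖ / ‖z‖ := by field_simp
    have hinner : |inner ℝ w (w - z)| / ‖w - z‖ ^ 2 ≤ 2 * ‖w‖ / ‖z‖ := by
      calc |inner ℝ w (w - z)| / ‖w - z‖ ^ 2 ≤ ‖w‖ * ‖w - z‖ / ‖w - z‖ ^ 2 := by
            gcongr
            exact abs_real_inner_le_norm _ _
        _ = ‖w‖ / ‖w - z‖ := by field_simp
        _ ≤ ‖w‖ / (‖z‖ / 2) := by gcongr
        _ = 2 * ‖w‖ / ‖z‖ := by field_simp
    have b1 : |R.s₁ (Real.log ‖w‖ + (T + 1 / 2))| ≤ 2 * R.C * hat (Real.log ‖w‖ + T) := by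
      have := R.bound₁ (Real.log ‖w‖ + (T + 1 / 2))
      nlinarith
    have b2 : |R.s₂ (Real.log ‖w‖ + (T + 1 / 2))| ≤ 2 * R.C * hat (Real.log ‖w‖ + T) := by
      have := R.bound₂ (Real.log ‖w‖ + (T + 1 / 2))
      nlinarith
    have hsplit : edgeKernel R.s₁ R.s₂ u (T + 1 / 2) z w
        - Real.log ‖z‖ * (R.s₂ (Real.log ‖w‖ + (T + 1 / 2)) / ‖w‖ ^ 2 * u w)
        = (R.s₂ (Real.log ‖w‖ + (T + 1 / 2)) * (Real.log ‖w - z‖ - Real.log ‖z‖)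
          + 2 * (R.s₁ (Real.log ‖w‖ + (T + 1 / 2)) * (inner ℝ w (w - z) / ‖w - z‖ ^ 2)))
          * (u w / ‖w‖ ^ 2) := by
      simp only [edgeKernel]
      ring
    have hH : 0 ≤ 2 * R.C * hat (Real.log ‖w‖ + T) := (abs_nonneg _).trans b1
    rw [hsplit, norm_mul, Real.norm_eq_abs, Real.norm_eq_abs, abs_div, abs_of_pos (pow_pos hw 2)]
    have hsum : |R.s₂ (Real.log ‖w‖ + (T + 1 / 2)) * (Real.log ‖w - z‖ - Real.log ‖z‖)
          + 2 * (R.s₁ (Real.log ‖w‖ + (T + 1 / 2)) * (inner ℝ w (w - z) / ‖w - z‖ ^ 2))|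
        ≤ 12 * R.C / ‖z‖ * Real.exp (1 / 2 - T) * hat (Real.log ‖w‖ + T) := by
      refine (abs_add_le _ _).trans ?_
      rw [abs_mul, abs_mul 2, abs_mul, abs_div (inner ℝ w (w - z)), abs_two,
        abs_of_pos (pow_pos hd0 2)]
      have m1 := mul_le_mul b2 hlog (abs_nonneg _) hH
      have m2 := mul_le_mul b1 hinner (by positivity) hH
      have m3 : 2 * R.C * hat (Real.log ‖w‖ + T) * (2 * ‖w‖ / ‖z‖)
          ≤ 2 * R.C * hat (Real.log ‖w‖ + T) * (2 * Real.exp (1 / 2 - T) / ‖z‖) := by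
        gcongr
      have m4 : 12 * R.C / ‖z‖ * Real.exp (1 / 2 - T) * hat (Real.log ‖w‖ + T)
          = 3 * (2 * R.C * hat (Real.log ‖w‖ + T) * (2 * Real.exp (1 / 2 - T) / ‖z‖)) := by ring
      rw [m4]
      linarith
    calc _ ≤ 12 * R.C / ‖z‖ * Real.exp (1 / 2 - T) * hat (Real.log ‖w‖ + T)
          * (|u w| / ‖w‖ ^ 2) := by gcongr
      _ = _ := by ring
  refine (norm_integral_le_of_norm_le (iA.const_mul _) (ae_of_all _ hbound)).trans ?_
  rw [integral_const_mul]
  have := mul_le_mul_of_nonneg_left (hCb T hT)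
    (show 0 ≤ 12 * R.C / ‖z‖ * Real.exp (1 / 2 - T) by positivity)
  refine this.trans (le_of_eq ?_)
  rw [sub_eq_add_neg, Real.exp_add]
  ring

lemma continuousAt_integral_edgeKernel (hu : ContinuousOn u (ball (0 : ℂ) 1 \ {0})) :
    ContinuousAt (fun z => ∫ w, edgeKernel R.s₁ R.s₂ u 2 z w) 0 := by
  have hua : ContinuousOn u (annulus (-2) (1 - 2)) := hu.mono (annulus_subset (by norm_num))
  set c : ℝ := Real.exp (-2) / 2 with hc
  have hc0 : 0 < c := by positivity
  have i1 := integrable_shift_radial_mul R.continuous_s₁.abs (fun t ht => R.supp₁ t (by simpa using ht))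
    hua.abs
  have i2 := integrable_shift_radial_mul R.continuous_s₂.abs (fun t ht => R.supp₂ t (by simpa using ht))
    hua.abs
  have hnear : ∀ᶠ z : ℂ in 𝓝 0, ‖z‖ < c := by
    filter_upwards [ball_mem_nhds (0 : ℂ) hc0] with z hz using by simpa using hz
  have hc1 : Real.exp (-2) < 1 := by rw [Real.exp_lt_one_iff]; norm_num
  have hmem : ∀ w : ℂ, w ≠ 0 → 0 ≤ Real.log ‖w‖ + 2 → Real.log ‖w‖ + 2 ≤ 1 →
      ∀ z : ℂ, ‖z‖ < c → ‖w‖ ≤ 1 ∧ c ≤ ‖w - z‖ ∧ ‖w - z‖ ≤ 2 := fun w h0 ha hb z hz => by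
    have hw : 0 < ‖w‖ := norm_pos_iff.2 h0
    have e1 : Real.exp (-2) ≤ ‖w‖ := (Real.le_log_iff_exp_le hw).1 (by linarith)
    have e2 : ‖w‖ ≤ 1 := by
      rw [← Real.log_nonpos_iff hw.le]
      linarith
    have := norm_sub_norm_le w z
    have := norm_sub_le w z
    refine ⟨e2, ?_, ?_⟩ <;> linarith
  refine continuousAt_of_dominated (bound := fun w =>
    (2 + c⁻¹) * (|R.s₂ (Real.log ‖w‖ + 2)| / ‖w‖ ^ 2 * |u w|)
      + 2 * c⁻¹ * (|R.s₁ (Real.log ‖w‖ + 2)| / ‖w‖ ^ 2 * |u w|)) ?_ ?_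
      ((i2.const_mul _).add (i1.const_mul _)) ?_
  · filter_upwards [hnear] with z hz
    refine (integrable_edgeKernel R.continuous_s₁ R.continuous_s₂ R.supp₁ R.supp₂ hua
      (notMem_annulus_of_norm_lt ?_)).aestronglyMeasurable
    linarith
  · filter_upwards [hnear] with z hz
    refine ae_of_all _ fun w => ?_
    rcases eq_or_ne w 0 with rfl | h0
    · simp [edgeKernel]
    rw [edgeKernel, Real.norm_eq_abs]
    refine (abs_add_le _ _).trans (add_le_add ?_ ?_)
    · rw [abs_mul, abs_mul, abs_div, abs_of_nonneg (sq_nonneg ‖w‖)]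
      by_cases hs : R.s₂ (Real.log ‖w‖ + 2) = 0
      · simp [hs]
      obtain ⟨h1, h2, h3⟩ := hmem w h0 (R.supp₂ _ hs).1 (R.supp₂ _ hs).2 z hz
      gcongr
      refine (abs_log_le_add_inv (hc0.trans_le h2)).trans ?_
      gcongr
    · by_cases hs : R.s₁ (Real.log ‖w‖ + 2) = 0
      · simp [hs]
      obtain ⟨h1, h2, h3⟩ := hmem w h0 (R.supp₁ _ hs).1 (R.supp₁ _ hs).2 z hz
      have hd := hc0.trans_le h2
      rw [abs_mul, abs_two, abs_div, abs_mul, abs_mul, abs_div, abs_of_nonneg (sq_nonneg ‖w‖),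
        abs_of_nonneg (sq_nonneg ‖w - z‖), mul_assoc 2]
      gcongr
      have : |inner ℝ w (w - z)| / ‖w - z‖ ^ 2 ≤ c⁻¹ := by
        calc |inner ℝ w (w - z)| / ‖w - z‖ ^ 2 ≤ ‖w‖ * ‖w - z‖ / ‖w - z‖ ^ 2 := by
              gcongr
              exact abs_real_inner_le_norm _ _
          _ = ‖w‖ / ‖w - z‖ := by field_simp
          _ ≤ 1 / c := by gcongr
          _ = c⁻¹ := one_div c
      calc _ = |inner ℝ w (w - z)| / ‖w - z‖ ^ 2
            * (|R.s₁ (Real.log ‖w‖ + 2)| / ‖w‖ ^ 2 * |u w|) := by ring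
        _ ≤ _ := by gcongr
  · refine ae_of_all _ fun w => ?_
    rcases eq_or_ne w 0 with rfl | h0
    · simp only [edgeKernel, norm_zero]
      simpa using continuousAt_const
    · have hn : ‖w - 0‖ ≠ 0 := by simpa using h0
      unfold edgeKernel
      refine ContinuousAt.add ?_ ?_
      · refine ContinuousAt.mul ?_ continuousAt_const
        exact ContinuousAt.log (f := fun z => ‖w - z‖) (by fun_prop) hn
      · exact continuousAt_const.mul (ContinuousAt.div (by fun_prop) (by fun_prop) (pow_ne_zero 2 hn))

end Expansion

section Expansion

/-- Isolated singularities with finite energy: the logarithmic term, a bounded continuous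
term and the logarithmic potential of an integrable density. -/
theorem exists_log_potential_expansion {u : ℂ → ℝ} {M : ℝ}
    (hu : ContDiffOn ℝ 2 u (ball (0 : ℂ) 1 \ {0}))
    (hf : IntegrableOn (lapl u) (ball (0 : ℂ) 1 \ {0}))
    (he : IntegrableOn (fun w => Real.exp (2 * u w)) (ball (0 : ℂ) 1 \ {0}))
    (hM : ∀ w ∈ ball (0 : ℂ) 1 \ {0}, -(M * Real.exp (2 * u w)) ≤ lapl u w)
    (h0 : ∀ w ∈ ball (0 : ℂ) 1 \ {0}, lapl u w ≤ 0) :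
    ∃ (γ M' : ℝ) (S N : ℂ → ℝ), ContinuousAt S 0 ∧ (∀ w, 0 ≤ N w) ∧ Integrable N ∧
      (∀ w ∉ ball (0 : ℂ) 1 \ {0}, N w = 0) ∧
      (∀ w ∈ ball (0 : ℂ) 1 \ {0}, N w ≤ M' * Real.exp (2 * u w)) ∧
      (∀ z ∈ ball (0 : ℂ) 1 \ {0}, Integrable fun w => Real.log ‖w - z‖ * N w) ∧
      ∀ z : ℂ, z ≠ 0 → ‖z‖ < Real.exp (-3) →
        u z = γ * Real.log ‖z‖ + S z - ∫ w, Real.log ‖w - z‖ * N w := by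
  obtain ⟨R⟩ := nonempty_radialCutoff
  have hL := logMass_pos
  have hs : Continuous R.s := continuous_iff_continuousAt.2 fun t => (R.hasDerivAt_s t).continuousAt
  have hΩ := isOpen_punctured.measurableSet
  have hmemΩ : ∀ z : ℂ, z ≠ 0 → ‖z‖ < Real.exp (-3) → z ∈ ball (0 : ℂ) 1 \ {0} := fun z hz0 hz =>
    ⟨mem_ball_zero_iff.2 (hz.trans (by rw [Real.exp_lt_one_iff]; norm_num)), by simpa using hz0⟩
  set I : ℝ → ℝ := fun T => ∫ w, R.s₂ (Real.log ‖w‖ + (T + 1 / 2)) / ‖w‖ ^ 2 * u w with hI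
  set E₂ : ℂ → ℝ := fun z => ∫ w, edgeKernel R.s₁ R.s₂ u 2 z w with hE₂
  set W : ℂ → ℝ := fun z => ∫ w, Real.log ‖w - z‖ * cutLapl R u w with hW
  have hlim : ∀ z : ℂ, z ≠ 0 → ‖z‖ < Real.exp (-3) →
      Tendsto (fun T => Real.log ‖z‖ * I T) atTop (𝓝 (W z - logMass * u z + E₂ z)) := by
    intro z hz0 hz
    have l1 := (tendsto_integral_annular R hu hf (hmemΩ z hz0 hz)).comp
      (tendsto_atTop_add_const_right atTop (1 / 2 : ℝ) tendsto_id)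
    have l2 := tendsto_integral_edgeKernel_sub R hu hf he hz0
    have l3 := ((l1.sub_const (logMass * u z)).add_const (E₂ z)).sub l2
    rw [sub_zero] at l3
    refine l3.congr' ?_
    filter_upwards [eventually_gt_atTop (1 / 2 - Real.log ‖z‖)] with T hT
    simp only [Function.comp_apply, id_eq]
    rw [annular_representation R hu hz0 hz (a := T + 1 / 2) (by linarith)]
    simp only [hI, hE₂]
    ring
  obtain ⟨J, hJ⟩ : ∃ J, Tendsto I atTop (𝓝 J) := by
    have hn : ‖((Real.exp (-4) : ℝ) : ℂ)‖ = Real.exp (-4) := by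
      rw [Complex.norm_real, Real.norm_of_nonneg (Real.exp_pos _).le]
    have := hlim ((Real.exp (-4) : ℝ) : ℂ) (norm_ne_zero_iff.1 (by rw [hn]; positivity))
      (by rw [hn]; exact Real.exp_lt_exp.2 (by norm_num))
    rw [hn, Real.log_exp] at this
    refine ⟨_, (this.const_mul (-4 : ℝ)⁻¹).congr fun T => ?_⟩
    ring
  refine ⟨-J / logMass, M / logMass, fun z => E₂ z / logMass, fun w => -cutLapl R u w / logMass,
    (continuousAt_integral_edgeKernel R hu.continuousOn).div_const _, fun w => ?_, ?_, fun w hw => ?_,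
    fun w hw => ?_, fun z hz => ?_, fun z hz0 hz => ?_⟩
  · refine div_nonneg ?_ hL.le
    by_cases hw : w ∈ ball (0 : ℂ) 1 \ {0}
    · rw [cutLapl, indicator_of_mem hw]
      have := R.le_one (Real.log ‖w‖ + 2)
      have := h0 w hw
      nlinarith
    · simp [cutLapl, indicator_of_notMem hw]
  · refine Integrable.div_const (Integrable.neg ?_) _
    refine (integrable_indicator_iff hΩ).2 (Integrable.mono hf ?_ (ae_of_all _ fun w => ?_))
    · exact (continuousOn_cutLapl_density R hu).aestronglyMeasurable hΩ
    · rw [norm_mul]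
      refine mul_le_of_le_one_left (norm_nonneg _) ?_
      rw [Real.norm_eq_abs, abs_le]
      constructor <;> linarith [R.le_one (Real.log ‖w‖ + 2), R.nonneg (Real.log ‖w‖ + 2)]
  · simp [cutLapl, indicator_of_notMem hw]
  · simp only [cutLapl, indicator_of_mem hw]
    rw [div_mul_eq_mul_div]
    gcongr
    have := R.le_one (Real.log ‖w‖ + 2)
    have := R.nonneg (Real.log ‖w‖ + 2)
    have := h0 w hw
    have := hM w hw
    nlinarith
  · have hi : IntegrableOn (fun w => (1 - R.s (Real.log ‖w‖ + 2)) * lapl u w)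
        (ball (0 : ℂ) 1 \ {0}) := by
      refine Integrable.mono hf ((continuousOn_cutLapl_density R hu).aestronglyMeasurable hΩ)
        (ae_of_all _ fun w => ?_)
      rw [norm_mul]
      refine mul_le_of_le_one_left (norm_nonneg _) ?_
      rw [Real.norm_eq_abs, abs_le]
      constructor <;> linarith [R.le_one (Real.log ‖w‖ + 2), R.nonneg (Real.log ‖w‖ + 2)]
    have := (integrable_log_norm_sub_mul_indicator isOpen_punctured sdiff_subset
      (continuousOn_cutLapl_density R hu) hi hz).mul_const (-logMass⁻¹)
    refine this.congr (ae_of_all _ fun w => ?_)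
    simp only [cutLapl]
    ring
  · have huniq := tendsto_nhds_unique (hlim z hz0 hz) (hJ.const_mul (Real.log ‖z‖))
    have hWz : ∫ w, Real.log ‖w - z‖ * (-cutLapl R u w / logMass) = -W z / logMass := by
      simp only [hW]
      rw [← integral_neg, ← integral_div]
      congr 1
      ext w
      ring
    rw [hWz]
    field_simp
    linarith

end Expansion

section BrezisMerle

lemma tendsto_setIntegral_ball_zero {f : ℂ → ℝ} (hf : Integrable f) :
    Tendsto (fun δ : ℝ => ∫ w in ball (0 : ℂ) δ, f w) (𝓝 0) (𝓝 0) := by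
  refine hf.tendsto_setIntegral_nhds_zero ?_
  have h : Tendsto (fun δ : ℝ => ENNReal.ofReal δ ^ 2 * NNReal.pi) (𝓝 0)
      (𝓝 (ENNReal.ofReal 0 ^ 2 * NNReal.pi)) := by
    refine ENNReal.Tendsto.mul_const ?_ (Or.inr ENNReal.coe_ne_top)
    exact ((ENNReal.continuous_pow 2).comp ENNReal.continuous_ofReal).tendsto 0
  have hz : ENNReal.ofReal 0 ^ 2 * (NNReal.pi : ℝ≥0∞) = 0 := by simp
  rw [hz] at h
  exact h.congr fun δ => (Complex.volume_ball 0 δ).symm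

/-- A Jensen-type inequality for densities of total mass at most one. -/
lemma exp_integral_le {α : Type*} [MeasurableSpace α] {μ : Measure α} {A t e : α → ℝ}
    (hA : Integrable A μ) (hA0 : ∀ w, 0 ≤ A w) (hA1 : ∫ w, A w ∂μ ≤ 1)
    (ht : Integrable (fun w => t w * A w) μ) (he : Integrable (fun w => e w * A w) μ)
    (hte : ∀ᵐ w ∂μ, A w ≠ 0 → Real.exp (t w) ≤ e w) :
    Real.exp (∫ w, t w * A w ∂μ) ≤ 1 + ∫ w, e w * A w ∂μ := by
  set a := ∫ w, t w * A w ∂μ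
  set m := ∫ w, A w ∂μ with hm
  have hm0 : 0 ≤ m := integral_nonneg hA0
  have hAt : Integrable (fun w => A w + t w * A w) μ := hA.add ht
  have key : Real.exp a * (m + a - a * m) ≤ ∫ w, e w * A w ∂μ := by
    have : ∫ w, Real.exp a * ((A w + t w * A w) - a * A w) ∂μ = Real.exp a * (m + a - a * m) := by
      rw [integral_const_mul, integral_sub hAt (hA.const_mul a), integral_add hA ht,
        integral_const_mul]
    rw [← this]
    refine integral_mono_ae ((hAt.sub (hA.const_mul a)).const_mul _) he ?_
    filter_upwards [hte] with w hw
    rcases eq_or_ne (A w) 0 with h0 | h0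
    · simp [h0]
    · have h1 : Real.exp a * (1 + t w - a) ≤ e w := by
        refine le_trans ?_ (hw h0)
        have := Real.add_one_le_exp (t w - a)
        have h2 : Real.exp (t w) = Real.exp a * Real.exp (t w - a) := by
          rw [← Real.exp_add]
          ring_nf
        rw [h2]
        have := Real.exp_pos a
        gcongr
        linarith
      have := mul_le_mul_of_nonneg_right h1 (hA0 w)
      linarith
  have h3 : Real.exp a * (1 - a) ≤ 1 := by
    have := Real.add_one_le_exp (-a)
    have h4 : Real.exp a * Real.exp (-a) = 1 := by rw [← Real.exp_add]; simp
    have := mul_le_mul_of_nonneg_left this (Real.exp_pos a).le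
    linarith
  nlinarith [mul_le_mul_of_nonneg_right h3 (show 0 ≤ 1 - m by linarith)]

lemma integrable_indicator_inv_norm :
    Integrable ((ball (0 : ℂ) 1).indicator fun w => ‖w‖⁻¹) := by
  refine (integrable_indicator_iff measurableSet_ball).2 ?_
  have := (locallyIntegrable_inv_norm_sub 0).integrableOn_isCompact (isCompact_closedBall (0 : ℂ) 1)
  simp only [sub_zero] at this
  exact this.mono_set ball_subset_closedBall

/-- Exponential integrability of logarithmic potentials near a point. -/
lemma exists_integrable_bound_exp_potential {N : ℂ → ℝ} (hN : Integrable N) (hN0 : ∀ w, 0 ≤ N w)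
    (hlog : ∀ z : ℂ, z ≠ 0 → ‖z‖ < 1 → Integrable fun w => Real.log ‖w - z‖ * N w)
    {κ : ℝ} (hκ : 0 < κ) :
    ∃ ρ, 0 < ρ ∧ ∃ G : ℂ → ℝ, IntegrableOn G (ball 0 ρ) ∧
      ∀ᵐ z : ℂ, z ∈ ball 0 ρ → Real.exp (-κ * ∫ w, Real.log ‖w - z‖ * N w) ≤ G z := by
  obtain ⟨ρ, hρ0, hρ1, hρm⟩ : ∃ ρ : ℝ, 0 < ρ ∧ ρ < 1 / 4 ∧
      κ * ∫ w in ball (0 : ℂ) (2 * ρ), N w < 1 := by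
    have h1 : Tendsto (fun ρ : ℝ => κ * ∫ w in ball (0 : ℂ) (2 * ρ), N w) (𝓝[>] 0) (𝓝 0) := by
      have h2 : Tendsto (fun ρ : ℝ => 2 * ρ) (𝓝[>] 0) (𝓝 0) := by
        have : Tendsto (fun ρ : ℝ => 2 * ρ) (𝓝 0) (𝓝 (2 * 0)) := tendsto_id.const_mul 2
        rw [mul_zero] at this
        exact this.mono_left nhdsWithin_le_nhds
      simpa using ((tendsto_setIntegral_ball_zero hN).comp h2).const_mul κ
    have h3 : ∀ᶠ ρ : ℝ in 𝓝[>] 0, ρ < 1 / 4 :=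
      (eventually_lt_nhds (by norm_num)).filter_mono nhdsWithin_le_nhds
    obtain ⟨ρ, ⟨h4, h5⟩, h6⟩ := ((h3.and (h1.eventually_lt_const one_pos)).and
      self_mem_nhdsWithin).exists
    exact ⟨ρ, h6, h4, h5⟩
  set A : ℂ → ℝ := (ball (0 : ℂ) (2 * ρ)).indicator fun w => κ * N w with hA
  have iA : Integrable A := (hN.const_mul κ).indicator measurableSet_ball
  have hA0 : ∀ w, 0 ≤ A w := fun w => indicator_nonneg (fun w _ => mul_nonneg hκ.le (hN0 w)) w
  have hA1 : ∫ w, A w ≤ 1 := by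
    rw [hA, integral_indicator measurableSet_ball, integral_const_mul]
    exact hρm.le
  have hAN : ∀ w, A w ≤ κ * N w := fun w =>
    indicator_le_self' (fun w _ => mul_nonneg hκ.le (hN0 w)) w
  set g : ℂ → ℝ := (ball (0 : ℂ) 1).indicator fun w => ‖w‖⁻¹ with hg
  have ig : Integrable g := integrable_indicator_inv_norm
  set L := ContinuousLinearMap.mul ℝ ℝ
  have iconv := iA.integrable_convolution L ig (μ := volume)
  set C : ℝ := Real.exp (|Real.log ρ| * (κ * ∫ w, N w)) with hC
  refine ⟨ρ, hρ0, fun z => C * (1 + convolution A g L volume z), ?_, ?_⟩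
  · exact ((integrableOn_const measure_ball_lt_top.ne).add iconv.integrableOn).const_mul C
  have hae0 : ∀ᵐ w : ℂ, w ≠ 0 := by simp [ae_iff, measure_singleton]
  filter_upwards [iA.ae_convolution_exists L ig (μ := volume), hae0] with z hz hz0 hzρ
  rw [mem_ball_zero_iff] at hzρ
  have hl := hlog z hz0 (by linarith)
  have haez : ∀ᵐ w : ℂ, w ≠ z := by simp [ae_iff, measure_singleton]
  have hclose : ∀ w ∈ ball (0 : ℂ) (2 * ρ), ‖w - z‖ < 1 := fun w hw => by
    have := norm_sub_le w z
    have := mem_ball_zero_iff.1 hw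
    linarith
  have iAl : Integrable fun w => -Real.log ‖w - z‖ * A w := by
    refine ((hl.const_mul (-κ)).indicator (s := ball (0 : ℂ) (2 * ρ)) measurableSet_ball).congr
      (ae_of_all _ fun w => ?_)
    by_cases hw : w ∈ ball (0 : ℂ) (2 * ρ)
    · simp only [hA, indicator_of_mem hw]
      ring
    · simp only [hA, indicator_of_notMem hw]
      ring
  have hconv : ∀ w, L (A w) (g (z - w)) = ‖w - z‖⁻¹ * A w := fun w => by
    by_cases hw : w ∈ ball (0 : ℂ) (2 * ρ)
    · have : z - w ∈ ball (0 : ℂ) 1 := by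
        rw [mem_ball_zero_iff, norm_sub_rev]
        exact hclose w hw
      simp only [L, hg, ContinuousLinearMap.mul_apply', indicator_of_mem this]
      rw [norm_sub_rev, mul_comm]
    · simp [L, hA, indicator_of_notMem hw]
  have ie : Integrable fun w => ‖w - z‖⁻¹ * A w := hz.congr (ae_of_all _ hconv)
  have hexp : Real.exp (∫ w, -Real.log ‖w - z‖ * A w) ≤ 1 + ∫ w, ‖w - z‖⁻¹ * A w := by
    refine exp_integral_le iA hA0 hA1 iAl ie ?_
    filter_upwards [haez] with w hw _
    rw [← Real.log_inv, Real.exp_log (inv_pos.2 (norm_pos_iff.2 (sub_ne_zero.2 hw)))]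
  have hrest : -κ * ∫ w, Real.log ‖w - z‖ * N w
      ≤ (∫ w, -Real.log ‖w - z‖ * A w) + |Real.log ρ| * (κ * ∫ w, N w) := by
    rw [← integral_const_mul, ← integral_const_mul, ← integral_const_mul,
      ← integral_add iAl ((hN.const_mul κ).const_mul _)]
    refine integral_mono (hl.const_mul _) (iAl.add ((hN.const_mul κ).const_mul _)) fun w => ?_
    change -κ * (Real.log ‖w - z‖ * N w) ≤ -Real.log ‖w - z‖ * A w + |Real.log ρ| * (κ * N w)
    have hn : 0 ≤ κ * N w := mul_nonneg hκ.le (hN0 w)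
    by_cases hw : w ∈ ball (0 : ℂ) (2 * ρ)
    · simp only [hA, indicator_of_mem hw]
      have : 0 ≤ |Real.log ρ| * (κ * N w) := by positivity
      linarith
    · simp only [hA, indicator_of_notMem hw]
      have h1 : 2 * ρ ≤ ‖w‖ := by simpa using hw
      have h2 := norm_sub_norm_le w z
      have h3 := Real.log_le_log hρ0 (show ρ ≤ ‖w - z‖ by linarith)
      have h4 := neg_abs_le (Real.log ρ)
      have := mul_le_mul_of_nonneg_right (show -Real.log ‖w - z‖ ≤ |Real.log ρ| by linarith) hn
      linarith
  calc Real.exp (-κ * ∫ w, Real.log ‖w - z‖ * N w)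
      ≤ Real.exp ((∫ w, -Real.log ‖w - z‖ * A w) + |Real.log ρ| * (κ * ∫ w, N w)) :=
        Real.exp_le_exp.2 hrest
    _ = C * Real.exp (∫ w, -Real.log ‖w - z‖ * A w) := by rw [Real.exp_add, mul_comm]
    _ ≤ C * (1 + ∫ w, ‖w - z‖⁻¹ * A w) := by gcongr
    _ = C * (1 + convolution A g L volume z) := by
        rw [convolution_def, integral_congr_ae (ae_of_all _ hconv)]

end BrezisMerle

section BrezisMerle

lemma abs_log_mul_le {x y b : ℝ} (hx : 0 < x) (hx1 : x ≤ 1) (hy : 0 ≤ y) (hb : 1 < b) :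
    |Real.log x| * y ≤ b.conjExponent ^ b.conjExponent * x⁻¹ + y ^ b := by
  have hc : b.HolderConjugate b.conjExponent := Real.HolderConjugate.conjExponent hb
  have hp := hc.symm.pos
  have h1 : |Real.log x| ≤ b.conjExponent * x ^ (-b.conjExponent⁻¹) := by
    have := (Real.abs_log_mul_self_rpow_lt x b.conjExponent⁻¹ hx hx1 (inv_pos.2 hp)).le
    rw [one_div, inv_inv, abs_mul, abs_of_pos (Real.rpow_pos_of_pos hx _)] at this
    rwa [Real.rpow_neg hx.le, ← div_eq_mul_inv, le_div_iff₀ (Real.rpow_pos_of_pos hx _)]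
  have h2 : |Real.log x| ^ b.conjExponent ≤ b.conjExponent ^ b.conjExponent * x⁻¹ := by
    refine (Real.rpow_le_rpow (abs_nonneg _) h1 hp.le).trans (le_of_eq ?_)
    rw [Real.mul_rpow hp.le (Real.rpow_pos_of_pos hx _).le, ← Real.rpow_mul hx.le, neg_mul,
      inv_mul_cancel₀ hp.ne', Real.rpow_neg_one]
  have h3 := Real.young_inequality_of_nonneg (abs_nonneg (Real.log x)) hy hc.symm
  have h4 : |Real.log x| ^ b.conjExponent / b.conjExponent ≤ |Real.log x| ^ b.conjExponent :=
    div_le_self (by positivity) hc.symm.lt.le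
  have h5 : y ^ b / b ≤ y ^ b := div_le_self (by positivity) hb.le
  linarith

/-- The logarithmic potential of a density that is `L^b` near the origin, `b > 1`,
is continuous at the origin. -/
lemma continuousAt_log_potential {N : ℂ → ℝ} (hN : Integrable N) (hN0 : ∀ w, 0 ≤ N w)
    (hout : ∀ w, 1 ≤ ‖w‖ → N w = 0) {b ρ : ℝ} (hb : 1 < b) (hρ : 0 < ρ)
    (hNb : IntegrableOn (fun w => N w ^ b) (ball 0 ρ)) :
    ContinuousAt (fun z => ∫ w, Real.log ‖w - z‖ * N w) 0 := by
  refine continuousAt_of_locally_uniform_approx_of_continuousAt fun U hU => ?_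
  obtain ⟨ε, hε, hεU⟩ := Metric.mem_uniformity_dist.1 hU
  set K := b.conjExponent ^ b.conjExponent with hK
  have hK0 : 0 ≤ K := Real.rpow_nonneg (Real.HolderConjugate.conjExponent hb).symm.pos.le _
  set g : ℂ → ℝ := (ball (0 : ℂ) 1).indicator fun w => ‖w‖⁻¹ with hg
  have ig : Integrable g := integrable_indicator_inv_norm
  have hg0 : ∀ w, 0 ≤ g w := fun w => indicator_nonneg (fun w _ => by positivity) w
  set Nb : ℂ → ℝ := (ball (0 : ℂ) ρ).indicator fun w => N w ^ b with hNbdef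
  have iNb : Integrable Nb := (integrable_indicator_iff measurableSet_ball).2 hNb
  obtain ⟨δ, hδ0, hδ1, hδρ, hδε⟩ : ∃ δ : ℝ, 0 < δ ∧ δ < 1 / 2 ∧ δ < ρ ∧
      K * (∫ w in ball (0 : ℂ) (2 * δ), g w) + ∫ w in ball (0 : ℂ) δ, Nb w < ε := by
    have hid : Tendsto (fun δ : ℝ => δ) (𝓝[>] 0) (𝓝 0) := nhdsWithin_le_nhds
    have h2 : Tendsto (fun δ : ℝ => 2 * δ) (𝓝[>] 0) (𝓝 0) := by simpa using hid.const_mul 2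
    have h1 := (((tendsto_setIntegral_ball_zero ig).comp h2).const_mul K).add
      ((tendsto_setIntegral_ball_zero iNb).comp hid)
    rw [mul_zero, add_zero] at h1
    obtain ⟨δ, ⟨⟨h4, h5⟩, h6⟩, h7⟩ := (((hid.eventually_lt_const (show (0 : ℝ) < 1 / 2 by norm_num)).and
      (hid.eventually_lt_const hρ)).and (h1.eventually_lt_const hε)).and self_mem_nhdsWithin |>.exists
    exact ⟨δ, h7, h4, h5, h6⟩
  set B := ball (0 : ℂ) δ with hB
  have hlogm : ∀ z : ℂ, Measurable fun w : ℂ => Real.log ‖w - z‖ := fun z => by fun_prop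
  have iBc : Integrable (Bᶜ.indicator N) := hN.indicator measurableSet_ball.compl
  have iB : Integrable (B.indicator N) := hN.indicator measurableSet_ball
  have igz : ∀ z : ℂ, Integrable fun w => K * g (w - z) := fun z =>
    (ig.comp_sub_right z).const_mul K
  have hfar : ∀ z ∈ ball (0 : ℂ) (δ / 2), ∀ w,
      ‖Real.log ‖w - z‖ * Bᶜ.indicator N w‖ ≤ (2 + (δ / 2)⁻¹) * Bᶜ.indicator N w := by
    intro z hz w
    rw [mem_ball_zero_iff] at hz
    rw [norm_mul, Real.norm_eq_abs, Real.norm_eq_abs,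
      abs_of_nonneg (indicator_nonneg (fun w _ => hN0 w) w : 0 ≤ Bᶜ.indicator N w)]
    by_cases hw : w ∈ Bᶜ
    · rw [indicator_of_mem hw]
      rcases le_or_gt 1 ‖w‖ with h1 | h1
      · simp [hout w h1]
      have h2 : δ ≤ ‖w‖ := by simpa [hB] using hw
      have h3 := norm_sub_norm_le w z
      have h4 := norm_sub_le w z
      have h5 : δ / 2 ≤ ‖w - z‖ := by linarith
      refine mul_le_mul_of_nonneg_right ?_ (hN0 w)
      refine (abs_log_le_add_inv (lt_of_lt_of_le (by positivity) h5)).trans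
        (add_le_add (by linarith) ?_)
      gcongr
    · simp [indicator_of_notMem hw]
  have ifar : ∀ z ∈ ball (0 : ℂ) (δ / 2), Integrable fun w => Real.log ‖w - z‖ * Bᶜ.indicator N w :=
    fun z hz => (iBc.const_mul _).mono'
      ((hlogm z).aestronglyMeasurable.mul iBc.aestronglyMeasurable) (ae_of_all _ (hfar z hz))
  have hnear : ∀ z ∈ ball (0 : ℂ) (δ / 2), ∀ᵐ w,
      ‖Real.log ‖w - z‖ * B.indicator N w‖ ≤ B.indicator (fun w => K * g (w - z) + Nb w) w := by
    intro z hz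
    rw [mem_ball_zero_iff] at hz
    have haez : ∀ᵐ w : ℂ, w ≠ z := by simp [ae_iff, measure_singleton]
    filter_upwards [haez] with w hwz
    by_cases hw : w ∈ B
    · have hw' := mem_ball_zero_iff.1 hw
      have h1 := norm_sub_le w z
      have h2 : w ∈ ball (0 : ℂ) ρ := mem_ball_zero_iff.2 (hw'.trans hδρ)
      have h3 : w - z ∈ ball (0 : ℂ) 1 := mem_ball_zero_iff.2 (by linarith)
      simp only [indicator_of_mem hw, hNbdef, hg, indicator_of_mem h2, indicator_of_mem h3]
      rw [norm_mul, Real.norm_eq_abs, Real.norm_of_nonneg (hN0 w)]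
      exact abs_log_mul_le (norm_pos_iff.2 (sub_ne_zero.2 hwz)) (mem_ball_zero_iff.1 h3).le
        (hN0 w) hb
    · simp [indicator_of_notMem hw]
  have ibound : ∀ z, Integrable (B.indicator fun w => K * g (w - z) + Nb w) := fun z =>
    ((igz z).add iNb).indicator measurableSet_ball
  have inear : ∀ z ∈ ball (0 : ℂ) (δ / 2), Integrable fun w => Real.log ‖w - z‖ * B.indicator N w :=
    fun z hz => (ibound z).mono'
      ((hlogm z).aestronglyMeasurable.mul iB.aestronglyMeasurable) (hnear z hz)
  have hball : ball (0 : ℂ) (δ / 2) ∈ 𝓝 (0 : ℂ) := ball_mem_nhds _ (by positivity)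
  refine ⟨ball 0 (δ / 2), hball, fun z => ∫ w, Real.log ‖w - z‖ * Bᶜ.indicator N w, ?_,
    fun z hz => hεU ?_⟩
  · refine continuousAt_of_dominated (bound := fun w => (2 + (δ / 2)⁻¹) * Bᶜ.indicator N w) ?_ ?_
      (iBc.const_mul _) ?_
    · filter_upwards [hball] with z hz using (ifar z hz).aestronglyMeasurable
    · filter_upwards [hball] with z hz using ae_of_all _ (hfar z hz)
    · have hae : ∀ᵐ w : ℂ, w ≠ 0 := by simp [ae_iff, measure_singleton]
      filter_upwards [hae] with w hw
      have hn : ‖w - 0‖ ≠ 0 := by simpa using hw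
      refine ContinuousAt.mul ?_ continuousAt_const
      exact ContinuousAt.log (f := fun z => ‖w - z‖) (by fun_prop) hn
  · have hsplit : ∫ w, Real.log ‖w - z‖ * N w = (∫ w, Real.log ‖w - z‖ * B.indicator N w)
        + ∫ w, Real.log ‖w - z‖ * Bᶜ.indicator N w := by
      rw [← integral_add (inear z hz) (ifar z hz)]
      refine integral_congr_ae (ae_of_all _ fun w => ?_)
      have := congrFun (indicator_self_add_compl B N) w
      simp only [Pi.add_apply] at this
      simp only [← mul_add, this]
    rw [hsplit, dist_eq_norm, add_sub_cancel_right]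
    refine lt_of_le_of_lt (norm_integral_le_of_norm_le (ibound z) (hnear z hz)) ?_
    rw [integral_indicator measurableSet_ball, integral_add (igz z).integrableOn iNb.integrableOn,
      integral_const_mul]
    refine lt_of_le_of_lt ?_ hδε
    gcongr
    rw [← integral_indicator measurableSet_ball, ← integral_indicator measurableSet_ball,
      ← integral_sub_right_eq_self (μ := volume) ((ball (0 : ℂ) (2 * δ)).indicator g) z]
    refine integral_mono ((ig.comp_sub_right z).indicator measurableSet_ball)
      ((ig.indicator measurableSet_ball).comp_sub_right z) fun w => ?_
    by_cases hw : w ∈ B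
    · have h1 := norm_sub_le w z
      have h2 := mem_ball_zero_iff.1 hw
      have h3 := mem_ball_zero_iff.1 hz
      have h4 : w - z ∈ ball (0 : ℂ) (2 * δ) := mem_ball_zero_iff.2 (by linarith)
      rw [indicator_of_mem hw, indicator_of_mem h4]
    · rw [indicator_of_notMem hw]
      exact indicator_nonneg (fun w _ => hg0 w) _

end BrezisMerle

section Conclusion

lemma locallyIntegrable_norm_rpow {a : ℝ} (ha : a < 2) :
    LocallyIntegrable (fun w : ℂ => ‖w‖ ^ (-a)) := by
  refine locallyIntegrable_of_norm_le_rpow (C := 1) (α := a) ?_ ?_ ?_ ?_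
  · simp [Complex.finrank_real_complex]
  · simpa [Complex.finrank_real_complex] using ha
  · refine ae_of_all _ fun w => ?_
    rw [one_mul, Real.norm_of_nonneg (Real.rpow_nonneg (norm_nonneg _) _)]
  · exact (by fun_prop : Measurable fun w : ℂ => ‖w‖ ^ (-a)).aestronglyMeasurable

lemma neg_one_lt_of_integrableOn_norm_rpow {γ r : ℝ} (hr : 0 < r)
    (h : IntegrableOn (fun w : ℂ => ‖w‖ ^ (2 * γ)) (ball 0 r)) : -1 < γ := by
  have h1 := (integrableOn_fun_norm_addHaar (volume : Measure ℂ)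
    (f := fun y : ℝ => y ^ (2 * γ)) (r := r)).1 h
  have h2 : IntegrableOn (fun y : ℝ => y ^ (2 * γ + 1)) (Ioo 0 r) := by
    refine h1.congr_fun (fun y hy => ?_) measurableSet_Ioo
    simp only [Complex.finrank_real_complex, Nat.add_one_sub_one, pow_one, smul_eq_mul]
    rw [Real.rpow_add hy.1, Real.rpow_one, mul_comm]
  have := (intervalIntegral.integrableOn_Ioo_rpow_iff hr).1 h2
  linarith

/-- Higher integrability of a density bounded by a subcritical power times the exponential of
its own logarithmic potential. -/
lemma exists_integrableOn_rpow {N : ℂ → ℝ} (hN : Integrable N) (hN0 : ∀ w, 0 ≤ N w)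
    (hlog : ∀ z : ℂ, z ≠ 0 → ‖z‖ < 1 → Integrable fun w => Real.log ‖w - z‖ * N w)
    {β r K : ℝ} (hβ0 : 0 ≤ β) (hβ : β < 1) (hr : 0 < r) (hK : 0 ≤ K)
    (hbound : ∀ w : ℂ, w ≠ 0 → ‖w‖ < r →
      N w ≤ K * (‖w‖ ^ (-(2 * β)) * Real.exp (-2 * ∫ v, Real.log ‖v - w‖ * N v))) :
    ∃ b ρ : ℝ, 1 < b ∧ 0 < ρ ∧ IntegrableOn (fun w => N w ^ b) (ball 0 ρ) := by
  set b : ℝ := √(2 / (1 + β)) with hbdef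
  have hb2 : b ^ 2 = 2 / (1 + β) := Real.sq_sqrt (by positivity)
  have hb : 1 < b := by
    rw [hbdef, Real.lt_sqrt (by norm_num), lt_div_iff₀ (by positivity)]
    linarith
  have hβb : 2 * β * b * b < 2 := by
    have : 2 * β * b * b = 2 * β * b ^ 2 := by ring
    rw [this, hb2, mul_div_assoc', div_lt_iff₀ (by positivity)]
    linarith
  have hc : b.HolderConjugate b.conjExponent := Real.HolderConjugate.conjExponent hb
  have hb0 : 0 < b := by linarith
  have hp := hc.symm.pos
  obtain ⟨ρ, hρ, G, hG, hGb⟩ := exists_integrable_bound_exp_potential hN hN0 hlog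
    (κ := 2 * b * b.conjExponent) (by positivity)
  refine ⟨b, min ρ r, hb, lt_min hρ hr, ?_⟩
  have hsub : ball (0 : ℂ) (min ρ r) ⊆ ball 0 ρ := ball_subset_ball (min_le_left _ _)
  have i1 : IntegrableOn (fun w : ℂ => ‖w‖ ^ (-(2 * β * b * b))) (ball 0 (min ρ r)) :=
    ((locallyIntegrable_norm_rpow hβb).integrableOn_isCompact
      (isCompact_closedBall 0 (min ρ r))).mono_set ball_subset_closedBall
  have hae0 : ∀ᵐ w : ℂ, w ≠ 0 := by simp [ae_iff, measure_singleton]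
  refine Integrable.mono' ((i1.add (hG.mono_set hsub)).const_mul (K ^ b))
    (hN.aestronglyMeasurable.restrict.aemeasurable.pow_const b).aestronglyMeasurable ?_
  rw [ae_restrict_iff' measurableSet_ball]
  filter_upwards [hGb, hae0] with w hw hw0 hwρ
  have hn : 0 < ‖w‖ := norm_pos_iff.2 hw0
  have hwr : ‖w‖ < r := (mem_ball_zero_iff.1 hwρ).trans_le (min_le_right _ _)
  have hwG := hw (hsub hwρ)
  rw [Real.norm_of_nonneg (Real.rpow_nonneg (hN0 w) b)]
  set I := ∫ v, Real.log ‖v - w‖ * N v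
  have hx : 0 ≤ ‖w‖ ^ (-(2 * β)) := Real.rpow_nonneg hn.le _
  calc N w ^ b ≤ (K * (‖w‖ ^ (-(2 * β)) * Real.exp (-2 * I))) ^ b :=
        Real.rpow_le_rpow (hN0 w) (hbound w hw0 hwr) hb0.le
    _ = K ^ b * (‖w‖ ^ (-(2 * β * b)) * Real.exp (-2 * I * b)) := by
        rw [Real.mul_rpow hK (by positivity), Real.mul_rpow hx (Real.exp_pos _).le,
          ← Real.rpow_mul hn.le, ← Real.exp_mul, neg_mul (2 * β)]
    _ ≤ K ^ b * (‖w‖ ^ (-(2 * β * b * b)) + G w) := by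
        gcongr
        have hy := Real.young_inequality_of_nonneg (Real.rpow_nonneg hn.le (-(2 * β * b)))
          (Real.exp_pos (-2 * I * b)).le hc
        rw [← Real.rpow_mul hn.le, ← Real.exp_mul, neg_mul (2 * β * b)] at hy
        have e1 : ‖w‖ ^ (-(2 * β * b * b)) / b ≤ ‖w‖ ^ (-(2 * β * b * b)) :=
          div_le_self (Real.rpow_nonneg hn.le _) hb.le
        have e2 : Real.exp (-2 * I * b * b.conjExponent) / b.conjExponent
            ≤ Real.exp (-2 * I * b * b.conjExponent) :=
          div_le_self (Real.exp_pos _).le hc.symm.lt.le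
        have e3 : -2 * I * b * b.conjExponent = -(2 * b * b.conjExponent) * I := by ring
        rw [e3] at hy e2
        linarith

/-- The expansion at an isolated singularity for a function with nonpositive Laplacian of
size at most `e^{2u}`. -/
lemma exists_expansion {u : ℂ → ℝ} {M : ℝ}
    (hu : ContDiffOn ℝ 2 u (ball (0 : ℂ) 1 \ {0}))
    (hf : IntegrableOn (lapl u) (ball (0 : ℂ) 1 \ {0}))
    (he : IntegrableOn (fun w => Real.exp (2 * u w)) (ball (0 : ℂ) 1 \ {0}))
    (hM : ∀ w ∈ ball (0 : ℂ) 1 \ {0}, -(M * Real.exp (2 * u w)) ≤ lapl u w)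
    (h0 : ∀ w ∈ ball (0 : ℂ) 1 \ {0}, lapl u w ≤ 0) :
    ∃ (γ : ℝ) (r : ℂ → ℝ), -1 < γ ∧ ContinuousOn r (ball (0 : ℂ) 1) ∧
      ∀ z ∈ ball (0 : ℂ) 1 \ {0}, u z = γ * Real.log ‖z‖ + r z := by
  obtain ⟨γ, M', S, N, hS, hN0, hN, hout, hNu, hlogΩ, hrep⟩ :=
    exists_log_potential_expansion hu hf he hM h0
  have hΩ : ∀ z : ℂ, z ≠ 0 → ‖z‖ < 1 → z ∈ ball (0 : ℂ) 1 \ {0} := fun z hz0 hz =>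
    ⟨mem_ball_zero_iff.2 hz, by simpa using hz0⟩
  have hlog : ∀ z : ℂ, z ≠ 0 → ‖z‖ < 1 → Integrable fun w => Real.log ‖w - z‖ * N w :=
    fun z hz0 hz => hlogΩ z (hΩ z hz0 hz)
  have hout1 : ∀ w : ℂ, 1 ≤ ‖w‖ → N w = 0 := fun w hw =>
    hout w fun h => absurd (mem_ball_zero_iff.1 h.1) (not_lt.2 hw)
  obtain ⟨r, hr0, hr3, hrS⟩ : ∃ r : ℝ, 0 < r ∧ r < Real.exp (-3) ∧
      ∀ z : ℂ, ‖z‖ < r → |S z| ≤ |S 0| + 1 := by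
    obtain ⟨r, hr, hrS⟩ := Metric.continuousAt_iff.1 hS 1 one_pos
    refine ⟨min r (Real.exp (-3) / 2), by positivity,
      (min_le_right _ _).trans_lt (half_lt_self (Real.exp_pos _)), fun z hz => ?_⟩
    have := hrS (x := z) (by simpa using hz.trans_le (min_le_left _ _))
    rw [Real.dist_eq] at this
    have := abs_sub_abs_le_abs_sub (S z) (S 0)
    linarith
  have he3 : Real.exp (-3) < 1 := by rw [Real.exp_lt_one_iff]; norm_num
  set W : ℂ → ℝ := fun z => ∫ w, Real.log ‖w - z‖ * N w with hW
  have hWle : ∀ z : ℂ, z ≠ 0 → ‖z‖ < 1 → W z ≤ Real.log 2 * ∫ w, N w := fun z hz0 hz => by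
    rw [← integral_const_mul]
    refine integral_mono (hlog z hz0 hz) (hN.const_mul _) fun w => ?_
    change Real.log ‖w - z‖ * N w ≤ Real.log 2 * N w
    rcases le_or_gt 1 ‖w‖ with h1 | h1
    · simp [hout1 w h1]
    refine mul_le_mul_of_nonneg_right ?_ (hN0 w)
    rcases eq_or_ne w z with rfl | hwz
    · simpa using Real.log_nonneg one_le_two
    · refine Real.log_le_log (norm_pos_iff.2 (sub_ne_zero.2 hwz)) ?_
      have := norm_sub_le w z
      linarith
  have hexp : ∀ z : ℂ, z ≠ 0 → ‖z‖ < Real.exp (-3) →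
      Real.exp (2 * u z) = ‖z‖ ^ (2 * γ) * Real.exp (2 * S z) * Real.exp (-2 * W z) :=
    fun z hz0 hz => by
      rw [hrep z hz0 hz, Real.rpow_def_of_pos (norm_pos_iff.2 hz0), ← Real.exp_add, ← Real.exp_add]
      congr 1
      ring
  have hγ : -1 < γ := by
    refine neg_one_lt_of_integrableOn_norm_rpow hr0 ?_
    have hae0 : ∀ᵐ w : ℂ, w ≠ 0 := by simp [ae_iff, measure_singleton]
    have hae : (ball (0 : ℂ) 1 \ {0} : Set ℂ) =ᵐ[volume] ball (0 : ℂ) 1 := sdiff_null_ae_eq_self (by simp)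
    have heb : IntegrableOn (fun w => Real.exp (2 * u w)) (ball (0 : ℂ) r) :=
      (he.congr_set_ae hae.symm).mono_set (ball_subset_ball (by linarith))
    set C := 2 * (|S 0| + 1) + 2 * (Real.log 2 * ∫ w, N w) with hC
    refine Integrable.mono' (heb.const_mul (Real.exp C))
      (by fun_prop : Measurable fun w : ℂ => ‖w‖ ^ (2 * γ)).aestronglyMeasurable ?_
    rw [ae_restrict_iff' measurableSet_ball]
    filter_upwards [hae0] with z hz0 hz
    have hzr := mem_ball_zero_iff.1 hz
    have h1 := hWle z hz0 (by linarith)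
    have h2 := (abs_le.1 (hrS z hzr)).1
    have hnn : 0 ≤ ‖z‖ ^ (2 * γ) := Real.rpow_nonneg (norm_nonneg _) _
    rw [Real.norm_of_nonneg hnn, hexp z hz0 (hzr.trans hr3)]
    have h3 : 1 ≤ Real.exp C * (Real.exp (2 * S z) * Real.exp (-2 * W z)) := by
      rw [← Real.exp_add, ← Real.exp_add]
      refine Real.one_le_exp ?_
      linarith
    calc ‖z‖ ^ (2 * γ) ≤ ‖z‖ ^ (2 * γ) * (Real.exp C * (Real.exp (2 * S z) * Real.exp (-2 * W z))) :=
          le_mul_of_one_le_right hnn h3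
      _ = _ := by ring
  obtain ⟨b, ρ, hb, hρ, hNb⟩ := exists_integrableOn_rpow hN hN0 hlog (β := max (-γ) 0)
    (K := |M'| * Real.exp (2 * (|S 0| + 1))) (le_max_right _ _) (max_lt (by linarith) one_pos) hr0
    (by positivity) fun w hw0 hwr => by
      have hn : 0 < ‖w‖ := norm_pos_iff.2 hw0
      have hw1 : ‖w‖ ≤ 1 := by linarith
      have h1 := hNu w (hΩ w hw0 (by linarith))
      have h2 := (abs_le.1 (hrS w hwr)).2
      have h3 : ‖w‖ ^ (2 * γ) ≤ ‖w‖ ^ (-(2 * max (-γ) 0)) := by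
        refine Real.rpow_le_rpow_of_exponent_ge hn hw1 ?_
        have := le_max_left (-γ) 0
        linarith
      calc N w ≤ |M'| * Real.exp (2 * u w) :=
            h1.trans (mul_le_mul_of_nonneg_right (le_abs_self _) (Real.exp_pos _).le)
        _ = |M'| * (‖w‖ ^ (2 * γ) * Real.exp (2 * S w) * Real.exp (-2 * W w)) := by
            rw [hexp w hw0 (hwr.trans hr3)]
        _ ≤ |M'| * (‖w‖ ^ (-(2 * max (-γ) 0)) * Real.exp (2 * (|S 0| + 1))
              * Real.exp (-2 * W w)) := by gcongr
        _ = _ := by ring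
  have hWc : ContinuousAt W 0 := continuousAt_log_potential hN hN0 hout1 hb hρ hNb
  refine ⟨γ, Function.update (fun z => u z - γ * Real.log ‖z‖) 0 (S 0 - W 0), hγ, fun z hz => ?_,
    fun z hz => ?_⟩
  · refine ContinuousAt.continuousWithinAt ?_
    rcases eq_or_ne z 0 with rfl | hz0
    · refine (hS.sub hWc).congr ?_
      filter_upwards [ball_mem_nhds (0 : ℂ) (Real.exp_pos (-3))] with w hw
      rcases eq_or_ne w 0 with rfl | hw0
      · simp
      · rw [Function.update_of_ne hw0, hrep w hw0 (mem_ball_zero_iff.1 hw)]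
        simp only [Pi.sub_apply, hW]
        ring
    · rw [continuousAt_update_of_ne hz0]
      have hzΩ := hΩ z hz0 (mem_ball_zero_iff.1 hz)
      refine (hu.continuousOn.continuousAt (isOpen_punctured.mem_nhds hzΩ)).sub ?_
      exact continuousAt_const.mul (ContinuousAt.log (by fun_prop) (norm_ne_zero_iff.2 hz0))
  · rw [Function.update_of_ne (by simpa using hz.2)]
    ring

lemma integrableOn_exp_two_mul {u : ℂ → ℝ} (hu : ContinuousOn u (ball (0 : ℂ) 1 \ {0}))
    (hint : ∫⁻ z in ball (0 : ℂ) 1, ENNReal.ofReal (Real.exp (2 * u z)) < ⊤) :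
    IntegrableOn (fun w => Real.exp (2 * u w)) (ball (0 : ℂ) 1 \ {0}) := by
  refine ⟨ContinuousOn.aestronglyMeasurable (by fun_prop) isOpen_punctured.measurableSet, ?_⟩
  rw [hasFiniteIntegral_iff_ofReal (ae_of_all _ fun w => (Real.exp_pos _).le)]
  exact (lintegral_mono_set sdiff_subset).trans_lt hint

end Conclusion

end

/-- Theorem 1.1 (existence of the expansion): if k is bounded, nonpositive and continuous
on the punctured unit disk, u is a C² solution of Δu = k·e^{2u} there with finite energy
∬_𝔻 e^{2u} dxdy < ∞, then u(z) = γ·log|z| + r(z) with γ > −1 and r continuous on 𝔻. -/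
theorem isolated_singularity_expansion (k u : ℂ → ℝ)
    (hk_cont : ContinuousOn k (ball (0 : ℂ) 1 \ {0}))
    (hk_bdd : ∃ M : ℝ, ∀ z ∈ ball (0 : ℂ) 1 \ {0}, |k z| ≤ M)
    (hk_nonpos : ∀ z ∈ ball (0 : ℂ) 1 \ {0}, k z ≤ 0)
    (hu : ContDiffOn ℝ 2 u (ball (0 : ℂ) 1 \ {0}))
    (hpde : ∀ z ∈ ball (0 : ℂ) 1 \ {0}, lapl u z = k z * Real.exp (2 * u z))
    (hint : ∫⁻ z in ball (0 : ℂ) 1, ENNReal.ofReal (Real.exp (2 * u z)) < ⊤) :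
    ∃ (γ : ℝ) (r : ℂ → ℝ), -1 < γ ∧ ContinuousOn r (ball (0 : ℂ) 1) ∧
      ∀ z ∈ ball (0 : ℂ) 1 \ {0}, u z = γ * Real.log ‖z‖ + r z := by
  obtain ⟨M, hM⟩ := hk_bdd
  have he := integrableOn_exp_two_mul hu.continuousOn hint
  have hms : MeasurableSet (ball (0 : ℂ) 1 \ {0}) := isOpen_punctured.measurableSet
  have hf : IntegrableOn (lapl u) (ball (0 : ℂ) 1 \ {0}) := by
    refine (he.const_mul M).mono'
      ((continuousOn_lapl isOpen_punctured hu).aestronglyMeasurable hms) ?_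
    refine (ae_restrict_iff' hms).2 (ae_of_all _ fun w hw => ?_)
    rw [hpde w hw, Real.norm_eq_abs, abs_mul, abs_of_pos (Real.exp_pos _)]
    exact mul_le_mul_of_nonneg_right (hM w hw) (Real.exp_pos _).le
  refine exists_expansion hu hf he (M := M) (fun w hw => ?_) fun w hw => ?_
  · rw [hpde w hw, ← neg_mul]
    exact mul_le_mul_of_nonneg_right (abs_le.1 (hM w hw)).1 (Real.exp_pos _).le
  · rw [hpde w hw]
    exact mul_nonpos_of_nonpos_of_nonneg (hk_nonpos w hw) (Real.exp_pos _).le
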